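/- arXiv:1006.4501 — 2 statements merged into one kernel-verified Lean document; each statement's English description precedes it below -/
import Mathlib

section
/- Let G be a finite simple graph with m := |E(G)| ≥ 7·10^10 edges, with m ≡ 1 (mod 3); set s := (m−1)/3. If the maximum degree satisfies Δ(G) ≤ 2s, then G admits a well guarded weighting w : V → {0,1,…,s}. -/
open SimpleGraph

/-- The weight of an edge induced by a vertex weighting `w` : for `e = xy`,
`edgeWt w e = w x + w y`. -/
def edgeWt {V : Type*} (w : V → ℕ) : Sym2 V → ℕ :=
  Sym2.lift ⟨fun x y => w x + w y, fun _ _ => Nat.add_comm _ _⟩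

/-- A vertex weighting `w` of a graph `G` with `3s+1` edges is *well guarded* if for every
`0 ≤ i ≤ 2s` we have `i + 1 ≤ |{e ∈ E : w(e) ≤ i}| ≤ i + s + 1`. -/
def WellGuarded {V : Type*} (G : SimpleGraph V) (s : ℕ) (w : V → ℕ) : Prop :=
  ∀ i ≤ 2 * s,
    i + 1 ≤ {e ∈ G.edgeSet | edgeWt w e ≤ i}.ncard ∧
    {e ∈ G.edgeSet | edgeWt w e ≤ i}.ncard ≤ i + s + 1


set_option linter.unusedSectionVars false

section Basics

variable {V : Type*} [Fintype V] [DecidableEq V] (G : SimpleGraph V) [DecidableRel G.Adj]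

/-- edges inside a set -/
def eIn (A : Finset V) : Finset (Sym2 V) := G.edgeFinset.filter (fun e => ∀ v ∈ e, v ∈ A)

/-- edges between two sets -/
def eCr (A B : Finset V) : Finset (Sym2 V) :=
  G.edgeFinset.filter (fun e => ∃ v ∈ A, ∃ u ∈ B, e = s(v, u))

/-- degree into a set -/
def dTo (v : V) (B : Finset V) : ℕ := (B.filter (fun u => G.Adj v u)).card

theorem mk_mem_eIn {A : Finset V} {x y : V} :
    s(x, y) ∈ eIn G A ↔ G.Adj x y ∧ x ∈ A ∧ y ∈ A := by
  simp [eIn]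

theorem mk_mem_eCr {A B : Finset V} {x y : V} :
    s(x, y) ∈ eCr G A B ↔ G.Adj x y ∧ ((x ∈ A ∧ y ∈ B) ∨ (y ∈ A ∧ x ∈ B)) := by
  simp only [eCr, Finset.mem_filter, SimpleGraph.mem_edgeFinset, SimpleGraph.mem_edgeSet,
    Sym2.eq_iff]
  constructor
  · rintro ⟨h, v, hv, u, hu, (⟨rfl, rfl⟩ | ⟨rfl, rfl⟩)⟩
    · exact ⟨h, Or.inl ⟨hv, hu⟩⟩
    · exact ⟨h, Or.inr ⟨hv, hu⟩⟩
  · rintro ⟨h, (⟨h1, h2⟩ | ⟨h1, h2⟩)⟩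
    · exact ⟨h, x, h1, y, h2, Or.inl ⟨rfl, rfl⟩⟩
    · exact ⟨h, y, h1, x, h2, Or.inr ⟨rfl, rfl⟩⟩

theorem card_eCr {A B : Finset V} (hAB : Disjoint A B) :
    (eCr G A B).card = ∑ v ∈ A, dTo G v B := by
  unfold dTo
  rw [← Finset.card_sigma]
  symm
  refine Finset.card_bij (fun p _ => s(p.1, p.2)) ?_ ?_ ?_
  · rintro ⟨v, u⟩ h
    simp only [Finset.mem_sigma, Finset.mem_filter] at h
    rw [mk_mem_eCr]
    exact ⟨h.2.2, Or.inl ⟨h.1, h.2.1⟩⟩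
  · rintro ⟨v, u⟩ h ⟨v', u'⟩ h' heq
    simp only [Finset.mem_sigma, Finset.mem_filter] at h h'
    rcases Sym2.eq_iff.1 heq with ⟨h1, h2⟩ | ⟨h1, h2⟩
    · simp only at h1 h2; subst h1; subst h2; rfl
    · exfalso
      simp only at h1 h2; subst h1; subst h2
      exact (Finset.disjoint_left.1 hAB h.1) h'.2.1
  · intro e
    induction e with | _ x y =>
    intro h
    rw [mk_mem_eCr] at h
    rcases h with ⟨h, (⟨h1, h2⟩ | ⟨h1, h2⟩)⟩
    · exact ⟨⟨x, y⟩, by simp [h1, h2, h], rfl⟩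
    · exact ⟨⟨y, x⟩, by simp [h1, h2, h.symm], Sym2.eq_swap⟩

theorem eIn_subset_edge (A : Finset V) : eIn G A ⊆ G.edgeFinset := Finset.filter_subset _ _
theorem eCr_subset_edge (A B : Finset V) : eCr G A B ⊆ G.edgeFinset := Finset.filter_subset _ _

theorem eIn_mono {A B : Finset V} (h : A ⊆ B) : eIn G A ⊆ eIn G B := by
  intro e he
  simp only [eIn, Finset.mem_filter] at he ⊢
  exact ⟨he.1, fun v hv => h (he.2 v hv)⟩

/-- decomposition of edges inside a disjoint union. -/
theorem card_eIn_union {A B : Finset V} (hAB : Disjoint A B) :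
    (eIn G (A ∪ B)).card = (eIn G A).card + (eIn G B).card + ∑ v ∈ A, dTo G v B := by
  rw [← card_eCr G hAB]
  have hd := Finset.disjoint_left.1 hAB
  rw [← Finset.card_union_of_disjoint, ← Finset.card_union_of_disjoint]
  · congr 1
    ext e
    induction e with | _ x y =>
    simp only [Finset.mem_union, mk_mem_eIn, mk_mem_eCr]
    tauto
  · rw [Finset.disjoint_left]
    intro e
    induction e with | _ x y =>
    simp only [Finset.mem_union, mk_mem_eIn, mk_mem_eCr]
    have := @hd x; have := @hd y
    tauto
  · rw [Finset.disjoint_left]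
    intro e
    induction e with | _ x y =>
    simp only [mk_mem_eIn]
    have := @hd x; have := @hd y
    tauto

theorem eIn_singleton (a : V) : (eIn G {a}).card = 0 := by
  rw [Finset.card_eq_zero, Finset.eq_empty_iff_forall_notMem]
  intro e
  induction e with | _ x y =>
  simp only [mk_mem_eIn, Finset.mem_singleton]
  rintro ⟨h, rfl, rfl⟩
  exact G.irrefl h

theorem card_eIn_insert {a : V} {B : Finset V} (h : a ∉ B) :
    (eIn G (insert a B)).card = (eIn G B).card + dTo G a B := by
  have := card_eIn_union G (A := {a}) (B := B) (by simpa using h)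
  rw [Finset.sum_singleton, eIn_singleton] at this
  rw [Finset.insert_eq, this]; omega

theorem card_eIn_erase {a : V} {B : Finset V} (h : a ∈ B) :
    (eIn G B).card = (eIn G (B.erase a)).card + dTo G a B := by
  have := card_eIn_insert G (a := a) (B := B.erase a) (by simp)
  rw [Finset.insert_erase h] at this
  rw [this]
  congr 1
  unfold dTo
  congr 1
  ext u
  simp only [Finset.mem_filter, Finset.mem_erase]
  constructor
  · tauto
  · rintro ⟨h1, h2⟩
    exact ⟨⟨fun h => by subst h; exact G.irrefl h2, h1⟩, h2⟩

theorem eIn_univ : eIn G Finset.univ = G.edgeFinset := by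
  ext e; simp [eIn]

theorem dTo_univ (v : V) : dTo G v Finset.univ = G.degree v := by
  unfold dTo
  rw [← SimpleGraph.card_neighborFinset_eq_degree]
  congr 1
  ext u; simp

theorem dTo_mono (v : V) {A B : Finset V} (h : A ⊆ B) : dTo G v A ≤ dTo G v B :=
  Finset.card_le_card (Finset.filter_subset_filter _ h)

theorem dTo_union (v : V) {A B : Finset V} (h : Disjoint A B) :
    dTo G v (A ∪ B) = dTo G v A + dTo G v B := by
  unfold dTo
  rw [Finset.filter_union, Finset.card_union_of_disjoint]
  exact Finset.disjoint_filter_filter h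

theorem sum_dTo_self (A : Finset V) : ∑ v ∈ A, dTo G v A = 2 * (eIn G A).card := by
  induction A using Finset.induction_on with
  | empty =>
    simp only [Finset.sum_empty]
    symm
    rw [Nat.mul_eq_zero]; right
    rw [Finset.card_eq_zero, Finset.eq_empty_iff_forall_notMem]
    intro e
    induction e with | _ x y => simp [mk_mem_eIn]
  | insert a B h ih =>
    rw [card_eIn_insert G h, Finset.sum_insert h]
    have h1 : ∀ v, dTo G v (insert a B) = dTo G v {a} + dTo G v B := by
      intro v
      rw [Finset.insert_eq, dTo_union]
      simpa using h
    simp only [h1, Finset.sum_add_distrib, ih]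
    have h2 : dTo G a {a} = 0 := by simp [dTo, Finset.filter_singleton]
    have h3 : ∑ v ∈ B, dTo G v {a} = dTo G a B := by
      unfold dTo
      rw [Finset.card_filter]
      refine Finset.sum_congr rfl fun v _ => ?_
      rw [Finset.filter_singleton]
      by_cases hv : G.Adj v a
      · simp [hv, hv.symm]
      · have : ¬ G.Adj a v := fun h => hv h.symm
        simp [hv, this]
    omega

/-- number of edges of small weight -/
def cntL (w : V → ℕ) (i : ℕ) : ℕ := (G.edgeFinset.filter (fun e => edgeWt w e ≤ i)).card

theorem cntL_eq (w : V → ℕ) (i : ℕ) :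
    {e ∈ G.edgeSet | edgeWt w e ≤ i}.ncard = cntL G w i := by
  unfold cntL
  rw [← Set.ncard_coe_finset]
  congr 1
  ext e; simp

theorem edgeWt_mk (w : V → ℕ) (x y : V) : edgeWt w s(x, y) = w x + w y := rfl

theorem wg_crit {s : ℕ} (hm : G.edgeFinset.card = 3 * s + 1) (w : V → ℕ)
    (hw : ∀ v, w v ≤ s)
    (ha : ∀ i < s, i + 1 ≤ (G.edgeFinset.filter (fun e => edgeWt w e ≤ i)).card)
    (hb : ∀ i < s, i + 1 ≤ (G.edgeFinset.filter (fun e => 2 * s - i ≤ edgeWt w e)).card)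
    (hc : ∀ i < s, (G.edgeFinset.filter (fun e => 2 * s - i ≤ edgeWt w e)).card ≤ s + i + 1)
    (hd : ∀ i < s, (G.edgeFinset.filter (fun e => edgeWt w e ≤ i)).card ≤ s + i + 1) :
    ∃ w : V → ℕ, (∀ v, w v ≤ s) ∧ WellGuarded G s w := by
  refine ⟨w, hw, fun i hi => ?_⟩
  rw [cntL_eq]
  unfold cntL
  rcases lt_or_ge i s with h | h
  · have := ha i h; have := hd i h; omega
  rcases eq_or_lt_of_le hi with h2 | h2
  · have : G.edgeFinset.filter (fun e => edgeWt w e ≤ i) = G.edgeFinset := by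
      rw [Finset.filter_eq_self]
      intro e _
      induction e with | _ x y =>
      rw [edgeWt_mk]; have := hw x; have := hw y; omega
    rw [this]; omega
  · have h3 := Finset.card_filter_add_card_filter_not (s := G.edgeFinset) (fun e => edgeWt w e ≤ i)
    have h4 : (G.edgeFinset.filter (fun e => ¬ edgeWt w e ≤ i)) =
        G.edgeFinset.filter (fun e => 2 * s - (2 * s - i - 1) ≤ edgeWt w e) := by
      apply Finset.filter_congr
      intro e _; omega
    rw [h4] at h3
    have := hb (2 * s - i - 1) (by omega)
    have := hc (2 * s - i - 1) (by omega)
    omega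

theorem exists_rank (W : Finset V) (f : V → ℕ) :
    ∃ ρ : V → ℕ, (∀ x ∈ W, ρ x < W.card) ∧ (∀ k ≤ W.card, (W.filter (fun x => ρ x < k)).card = k) ∧
      ∀ x ∈ W, ∀ y ∈ W, ρ x < ρ y → f x ≤ f y := by
  induction hn : W.card generalizing W with
  | zero =>
    refine ⟨fun _ => 0, ?_, ?_, ?_⟩
    · rw [Finset.card_eq_zero] at hn; simp [hn]
    · intro k hk; rw [Finset.card_eq_zero] at hn; simp [hn]; omega
    · simp
  | succ n ih =>
    obtain ⟨a, ha, hmax⟩ := Finset.exists_max_image W f (Finset.card_pos.1 (by omega))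
    obtain ⟨ρ, h1, h2, h3⟩ := ih (W.erase a) (by rw [Finset.card_erase_of_mem ha]; omega)
    refine ⟨fun x => if x = a then n else ρ x, ?_, ?_, ?_⟩
    · intro x hx
      by_cases hxa : x = a
      · simp [hxa]
      · simp only [hxa, if_false]
        have := h1 x (Finset.mem_erase.2 ⟨hxa, hx⟩); omega
    · intro k hk
      rcases Nat.lt_or_ge n k with h | h
      · have hk' : k = n + 1 := by omega
        subst hk'
        rw [Finset.filter_true_of_mem, hn]
        intro x hx
        by_cases hxa : x = a
        · simp [hxa]
        · simp only [hxa, if_false]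
          have := h1 x (Finset.mem_erase.2 ⟨hxa, hx⟩); omega
      · refine Eq.trans ?_ (h2 k h)
        congr 1
        ext x
        simp only [Finset.mem_filter, Finset.mem_erase]
        by_cases hxa : x = a
        · simp only [hxa, if_true]; constructor
          · rintro ⟨_, h⟩; omega
          · tauto
        · simp [hxa]
    · intro x hx y hy hxy
      by_cases hya : y = a
      · subst hya; exact hmax x hx
      · by_cases hxa : x = a
        · simp only [hxa, hya, if_true, if_false] at hxy
          have := h1 y (Finset.mem_erase.2 ⟨hya, hy⟩); omega
        · simp only [hxa, hya, if_false] at hxy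
          exact h3 x (Finset.mem_erase.2 ⟨hxa, hx⟩) y (Finset.mem_erase.2 ⟨hya, hy⟩) hxy

end Basics


section RegimeOneA

variable {V : Type*} [Fintype V] [DecidableEq V] (G : SimpleGraph V) [DecidableRel G.Adj]

theorem exists_sub_simple (A : Finset V) (q : ℕ) (hq : q ≤ A.card) :
    ∃ W ⊆ A, W.card = q ∧ ((eIn G W).card = 0 ∨
      (eIn G W).card + A.card ≤ (eIn G A).card + q) := by
  induction hn : A.card - q generalizing A with
  | zero => exact ⟨A, subset_rfl, by omega, by right; omega⟩
  | succ n ih =>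
    by_cases h : ∃ v ∈ A, 1 ≤ dTo G v A
    · obtain ⟨v, hv, hd⟩ := h
      have hc := Finset.card_erase_of_mem hv
      obtain ⟨W, h1, h2, h3⟩ := ih (A.erase v) (by omega) (by omega)
      refine ⟨W, h1.trans (Finset.erase_subset _ _), h2, ?_⟩
      have := card_eIn_erase G hv
      omega
    · push Not at h
      obtain ⟨W, h1, h2⟩ := Finset.exists_subset_card_eq hq
      refine ⟨W, h1, h2, Or.inl ?_⟩
      have h3 := sum_dTo_self G A
      rw [Finset.sum_eq_zero (fun v hv => by have := h v hv; omega)] at h3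
      have := Finset.card_le_card (eIn_mono G h1)
      omega

theorem exists_sub_C (A : Finset V) (q : ℕ) (hq : q ≤ A.card) :
    ∃ W ⊆ A, W.card = q ∧ ((eIn G W).card = 0 ∨
      3 * (eIn G W).card + 2 * A.card ≤ (eIn G A).card + 3 * q ∨
      3 * (eIn G W).card + 6 * A.card ≤ 3 * (eIn G A).card + 6 * q) := by
  induction hn : A.card - q generalizing A with
  | zero => exact ⟨A, subset_rfl, by omega, by right; right; omega⟩
  | succ n ih =>
    by_cases h : ∃ v ∈ A, 2 ≤ dTo G v A
    · obtain ⟨v, hv, hd⟩ := h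
      have hc := Finset.card_erase_of_mem hv
      obtain ⟨W, h1, h2, h3⟩ := ih (A.erase v) (by omega) (by omega)
      refine ⟨W, h1.trans (Finset.erase_subset _ _), h2, ?_⟩
      have := card_eIn_erase G hv
      omega
    · push Not at h
      obtain ⟨W, h1, h2, h3⟩ := exists_sub_simple G A q hq
      refine ⟨W, h1, h2, ?_⟩
      have h4 := sum_dTo_self G A
      have h5 : ∑ v ∈ A, dTo G v A ≤ ∑ v ∈ A, 1 :=
        Finset.sum_le_sum fun v hv => by have := h v hv; omega
      simp at h5
      omega

theorem eIn_sdiff_lt {A Z : Finset V} {T : Finset (Sym2 V)} (hT : T ⊆ eIn G A)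
    (hZ : ∀ e ∈ T, ∃ v ∈ e, v ∈ Z) : (eIn G (A \ Z)).card + T.card ≤ (eIn G A).card := by
  rw [← Finset.card_union_of_disjoint]
  · apply Finset.card_le_card
    apply Finset.union_subset (eIn_mono G Finset.sdiff_subset) hT
  · rw [Finset.disjoint_left]
    intro e he heT
    obtain ⟨v, hv, hvZ⟩ := hZ e heT
    have := (Finset.mem_filter.1 he).2 v hv
    simp [hvZ] at this

theorem exists_W {s x : ℕ} (hs : 100 ≤ s) (hx : 3 * x ≤ s) (N V' : Finset V) (hNV : N ⊆ V')
    (hN : N.card + x = 2 * s) (hr : (eIn G V').card = s + 1 + x) :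
    ∃ W ⊆ N, W.card = s ∧ (eIn G W).card ≤ x ∧ 1 ≤ (eIn G (V' \ W)).card := by
  by_cases hA : ∃ u ∈ V', ∃ v ∈ V', G.Adj u v ∧ u ∉ N
  · obtain ⟨u, hu, v, hv, huv, huN⟩ := hA
    have h1 : (eIn G (V' \ {u, v})).card + ({s(u, v)} : Finset (Sym2 V)).card ≤ _ :=
      eIn_sdiff_lt G (by simp [mk_mem_eIn, huv, hu, hv]) (by simp)
    have h2 : (eIn G (N.erase v)).card ≤ (eIn G (V' \ {u, v})).card := by
      apply Finset.card_le_card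
      apply eIn_mono
      intro y hy
      rw [Finset.mem_erase] at hy
      simp only [Finset.mem_sdiff, Finset.mem_insert, Finset.mem_singleton, not_or]
      exact ⟨hNV hy.2, fun h => huN (h ▸ hy.2), hy.1⟩
    have h3 : N.card - 1 ≤ (N.erase v).card := Finset.pred_card_le_card_erase
    obtain ⟨W, hW, hc, h⟩ := exists_sub_C G (N.erase v) s (by omega)
    simp at h1
    refine ⟨W, hW.trans (Finset.erase_subset _ _), hc, by omega, ?_⟩
    apply Finset.card_pos.2
    refine ⟨s(u, v), ?_⟩
    rw [mk_mem_eIn]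
    refine ⟨huv, ?_, ?_⟩
    · simp only [Finset.mem_sdiff]
      exact ⟨hu, fun h => huN (Finset.mem_of_mem_erase (hW h))⟩
    · simp only [Finset.mem_sdiff]
      exact ⟨hv, fun h => by simpa using hW h⟩
  push Not at hA
  have hB : ∃ v ∈ V', 2 ≤ dTo G v V' := by
    by_contra hcon
    push Not at hcon
    have h4 := sum_dTo_self G V'
    rw [← Finset.sum_subset hNV] at h4
    · have h5 : ∑ v ∈ N, dTo G v V' ≤ ∑ v ∈ N, 1 :=
        Finset.sum_le_sum fun v hv => by have := hcon v (hNV hv); omega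
      simp at h5
      omega
    · intro v hv hvN
      unfold dTo
      rw [Finset.card_eq_zero, Finset.filter_eq_empty_iff]
      intro u hu hvu
      exact hvN (hA v hv u hu hvu)
  obtain ⟨v, hv, hd⟩ := hB
  obtain ⟨u, hu, z, hz, huz⟩ := Finset.one_lt_card.1 (show 1 < (V'.filter (fun u => G.Adj v u)).card from hd)
  rw [Finset.mem_filter] at hu hz
  obtain ⟨hu, hvu⟩ := hu
  obtain ⟨hz, hvz⟩ := hz
  have nvu := hvu.ne
  have nvz := hvz.ne
  by_cases hC : ∃ y ∈ V', G.Adj u y ∧ y ≠ v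
  · obtain ⟨y, hy, huy, hyv⟩ := hC
    have nuy := huy.ne
    have h1 : (eIn G (V' \ {u, v})).card + ({s(u, v), s(v, z), s(u, y)} : Finset (Sym2 V)).card ≤ _ :=
      eIn_sdiff_lt G (by
        intro e he
        simp only [Finset.mem_insert, Finset.mem_singleton] at he
        rcases he with rfl | rfl | rfl <;> rw [mk_mem_eIn]
        · exact ⟨hvu.symm, hu, hv⟩
        · exact ⟨hvz, hv, hz⟩
        · exact ⟨huy, hu, hy⟩) (by simp)
    have h0 : ({s(u, v), s(v, z), s(u, y)} : Finset (Sym2 V)).card = 3 := by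
      rw [Finset.card_eq_three]
      refine ⟨_, _, _, ?_, ?_, ?_, rfl⟩
      · rw [Ne, Sym2.eq_iff]; push Not; exact ⟨fun h => absurd h.symm nvu, fun h => absurd h huz⟩
      · rw [Ne, Sym2.eq_iff]; push Not; exact ⟨fun _ h => hyv h.symm, fun h => absurd h nuy⟩
      · rw [Ne, Sym2.eq_iff]; push Not; exact ⟨fun h => absurd h nvu, fun _ h => huz h.symm⟩
    have h2 : (eIn G (N \ {u, v})).card ≤ (eIn G (V' \ {u, v})).card :=
      Finset.card_le_card (eIn_mono G (Finset.sdiff_subset_sdiff hNV subset_rfl))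
    have h3 : N.card - ({u, v} : Finset V).card ≤ (N \ {u, v}).card := Finset.le_card_sdiff _ _
    have h3' : ({u, v} : Finset V).card ≤ 2 := Finset.card_le_two
    obtain ⟨W, hW, hc, h⟩ := exists_sub_C G (N \ {u, v}) s (by omega)
    rw [h0] at h1
    refine ⟨W, hW.trans Finset.sdiff_subset, hc, by omega, ?_⟩
    apply Finset.card_pos.2
    refine ⟨s(u, v), ?_⟩
    rw [mk_mem_eIn]
    refine ⟨hvu.symm, ?_, ?_⟩
    · simp only [Finset.mem_sdiff]
      exact ⟨hu, fun h => by simpa using hW h⟩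
    · simp only [Finset.mem_sdiff]
      exact ⟨hv, fun h => by simpa using hW h⟩
  · push Not at hC
    have huN : u ∈ N := hA u hu v hv hvu.symm
    have h1 : (eIn G (V' \ {u, v, z})).card + ({s(u, v), s(v, z)} : Finset (Sym2 V)).card ≤ _ :=
      eIn_sdiff_lt G (by
        intro e he
        simp only [Finset.mem_insert, Finset.mem_singleton] at he
        rcases he with rfl | rfl <;> rw [mk_mem_eIn]
        · exact ⟨hvu.symm, hu, hv⟩
        · exact ⟨hvz, hv, hz⟩) (by simp)
    have h0 : ({s(u, v), s(v, z)} : Finset (Sym2 V)).card = 2 := by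
      rw [Finset.card_pair]
      rw [Ne, Sym2.eq_iff]; push Not; exact ⟨fun h => absurd h.symm nvu, fun h => absurd h huz⟩
    have h2 : (eIn G (N \ {u, v, z})).card ≤ (eIn G (V' \ {u, v, z})).card :=
      Finset.card_le_card (eIn_mono G (Finset.sdiff_subset_sdiff hNV subset_rfl))
    have h3 : N.card - ({u, v, z} : Finset V).card ≤ (N \ {u, v, z}).card := Finset.le_card_sdiff _ _
    have h3' : ({u, v, z} : Finset V).card ≤ 3 := Finset.card_le_three
    obtain ⟨W, hW, hc, h⟩ := exists_sub_C G (N \ {u, v, z}) (s - 1) (by omega)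
    rw [h0] at h1
    have huW : u ∉ W := fun h => by simpa using hW h
    have hvW : v ∉ W := fun h => by simpa using hW h
    have hzW : z ∉ W := fun h => by simpa using hW h
    have hdu : dTo G u W = 0 := by
      unfold dTo
      rw [Finset.card_eq_zero, Finset.filter_eq_empty_iff]
      intro y hy huy
      have hyN := hW hy
      rw [Finset.mem_sdiff] at hyN
      have := hC y (hNV hyN.1) huy
      exact hvW (this ▸ hy)
    have h6 := card_eIn_insert G huW
    refine ⟨insert u W, ?_, ?_, by omega, ?_⟩
    · apply Finset.insert_subset huN (hW.trans Finset.sdiff_subset)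
    · rw [Finset.card_insert_of_notMem huW]; omega
    apply Finset.card_pos.2
    refine ⟨s(v, z), ?_⟩
    rw [mk_mem_eIn]
    refine ⟨hvz, ?_, ?_⟩
    · simp only [Finset.mem_sdiff, Finset.mem_insert, not_or]
      exact ⟨hv, nvu, hvW⟩
    · simp only [Finset.mem_sdiff, Finset.mem_insert, not_or]
      exact ⟨hz, huz.symm, hzW⟩

end RegimeOneA


section RegimeOneB

variable {V : Type*} [Fintype V] [DecidableEq V] (G : SimpleGraph V) [DecidableRel G.Adj]

theorem card_eCr_star (c : V) (B : Finset V) (hc : c ∉ B) (hB : ∀ v ∈ B, G.Adj c v) :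
    (eCr G {c} B).card = B.card := by
  rw [card_eCr G (by simpa using hc), Finset.sum_singleton]
  unfold dTo
  rw [Finset.filter_true_of_mem hB]

theorem regime1_main {s x : ℕ} (hx : 3 * x ≤ s) (hm : G.edgeFinset.card = 3 * s + 1)
    (c : V) (V' : Finset V) (hV' : V' = Finset.univ.erase c)
    (hr : (eIn G V').card = s + 1 + x) (W : Finset V) (hcW : ∀ v ∈ W, G.Adj c v)
    (hWs : W.card = s) (hWx : (eIn G W).card ≤ x) (hW1 : 1 ≤ (eIn G (V' \ W)).card)
    (hz : (W.filter (fun v => dTo G v (V' \ W) = 0)).card ≤ s - x) :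
    ∃ w : V → ℕ, (∀ v, w v ≤ s) ∧ WellGuarded G s w := by
  obtain ⟨ρ, hρ1, hρ2, hρ3⟩ := exists_rank W (fun v => dTo G v (V' \ W))
  rw [hWs] at hρ1 hρ2
  have hcnW : c ∉ W := fun h => G.irrefl (hcW c h)
  have hWV : W ⊆ V' := by
    intro v hv; rw [hV']; simp; rintro rfl; exact hcnW hv
  have hmV : ∀ v, v ∈ V' ↔ v ≠ c := by intro v; rw [hV']; simp
  have hdec : (eIn G V').card = (eIn G W).card + (eIn G (V' \ W)).card +
      ∑ v ∈ W, dTo G v (V' \ W) := by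
    rw [← card_eIn_union G Finset.disjoint_sdiff, Finset.union_sdiff_of_subset hWV]
  set w : V → ℕ := fun v => if v = c then 0 else if v ∈ W then ρ v else s with hw
  have hwc : w c = 0 := by simp [hw]
  have hwW : ∀ v ∈ W, w v = ρ v := by
    intro v hv
    have : v ≠ c := by rintro rfl; exact hcnW hv
    simp [hw, this, hv]
  have hwO : ∀ v, v ≠ c → v ∉ W → w v = s := by
    intro v h1 h2; simp [hw, h1, h2]
  have hws : ∀ v, w v ≤ s := by
    intro v
    by_cases h1 : v = c
    · rw [h1, hwc]; omega
    by_cases h2 : v ∈ W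
    · rw [hwW v h2]; exact (hρ1 v h2).le
    · rw [hwO v h1 h2]
  have hcross : ∀ k, (eCr G (W.filter (fun v => ρ v < k)) (V' \ W)).card =
      ∑ v ∈ W.filter (fun v => ρ v < k), dTo G v (V' \ W) := by
    intro k
    apply card_eCr
    rw [Finset.disjoint_left]
    intro v hv; simp [(Finset.mem_filter.1 hv).1]
  refine wg_crit G hm w hws ?_ ?_ ?_ ?_
  · intro i hi
    have h1 := card_eCr_star G c (W.filter (fun v => ρ v < i + 1)) (by simp [hcnW])
      (fun v hv => hcW v (Finset.mem_filter.1 hv).1)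
    rw [hρ2 (i + 1) (by omega)] at h1
    rw [← h1]
    apply Finset.card_le_card
    intro e
    induction e with | _ a b =>
    rw [mk_mem_eCr]
    simp only [Finset.mem_singleton, Finset.mem_filter, SimpleGraph.mem_edgeFinset,
      SimpleGraph.mem_edgeSet, edgeWt_mk]
    rintro ⟨hab, (⟨rfl, h2, h3⟩ | ⟨rfl, h2, h3⟩)⟩
    · refine ⟨hab, ?_⟩; rw [hwc, hwW _ h2]; omega
    · refine ⟨hab, ?_⟩; rw [hwc, hwW _ h2]; omega
  · intro i hi
    have h1 : eIn G V' ⊆ (G.edgeFinset.filter (fun e => 2 * s - i ≤ edgeWt w e)) ∪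
        (eIn G W ∪ eCr G (W.filter (fun v => ρ v < s - i)) (V' \ W)) := by
      intro e
      induction e with | _ a b =>
      simp only [Finset.mem_union, mk_mem_eIn, mk_mem_eCr, Finset.mem_filter,
        SimpleGraph.mem_edgeFinset, SimpleGraph.mem_edgeSet, edgeWt_mk, Finset.mem_sdiff]
      rintro ⟨hab, ha, hb⟩
      have ha' := (hmV a).1 ha
      have hb' := (hmV b).1 hb
      by_cases haW : a ∈ W <;> by_cases hbW : b ∈ W
      · tauto
      · rw [hwW a haW, hwO b hb' hbW]
        rcases lt_or_ge (ρ a) (s - i) with h | h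
        · tauto
        · left; exact ⟨hab, by omega⟩
      · rw [hwW b hbW, hwO a ha' haW]
        rcases lt_or_ge (ρ b) (s - i) with h | h
        · tauto
        · left; exact ⟨hab, by omega⟩
      · rw [hwO b hb' hbW, hwO a ha' haW]
        left; exact ⟨hab, by omega⟩
    have h2 := (Finset.card_le_card h1).trans (Finset.card_union_le _ _)
    have h3 := Finset.card_union_le (eIn G W) (eCr G (W.filter (fun v => ρ v < s - i)) (V' \ W))
    rw [hcross] at h3
    have hk := hρ2 (s - i) (by omega)
    have hsplit := Finset.sum_filter_add_sum_filter_not W (fun v => ρ v < s - i)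
      (fun v => dTo G v (V' \ W))
    have hcs := Finset.card_filter_add_card_filter_not (s := W) (fun v => ρ v < s - i)
    by_cases hbig : ∃ v ∈ W.filter (fun v => ρ v < s - i), 2 ≤ dTo G v (V' \ W)
    · obtain ⟨v, hv, hv2⟩ := hbig
      rw [Finset.mem_filter] at hv
      have h4 : ∑ u ∈ W.filter (fun v => ¬ ρ v < s - i), 1 ≤
          ∑ u ∈ W.filter (fun v => ¬ ρ v < s - i), dTo G u (V' \ W) := by
        apply Finset.sum_le_sum
        intro u hu
        rw [Finset.mem_filter] at hu
        have := hρ3 v hv.1 u hu.1 (by omega)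
        omega
      simp only [Finset.sum_const, smul_eq_mul, mul_one] at h4
      omega
    · push Not at hbig
      have h4 : ∑ u ∈ W.filter (fun v => ρ v < s - i), dTo G u (V' \ W) ≤
          ∑ u ∈ W.filter (fun v => ρ v < s - i), 1 := by
        apply Finset.sum_le_sum
        intro u hu
        have := hbig u hu
        omega
      simp only [Finset.sum_const, smul_eq_mul, mul_one] at h4
      omega
  · intro i hi
    have h1 : (G.edgeFinset.filter (fun e => 2 * s - i ≤ edgeWt w e)) ∪
        eCr G (W.filter (fun v => ρ v < s - i)) (V' \ W) ⊆ eIn G V' := by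
      intro e
      induction e with | _ a b =>
      simp only [Finset.mem_union, mk_mem_eIn, mk_mem_eCr, Finset.mem_filter,
        SimpleGraph.mem_edgeFinset, SimpleGraph.mem_edgeSet, edgeWt_mk, Finset.mem_sdiff]
      rintro (⟨hab, h⟩ | ⟨hab, h⟩)
      · refine ⟨hab, (hmV a).2 ?_, (hmV b).2 ?_⟩
        · rintro rfl; rw [hwc] at h; have := hws b; omega
        · rintro rfl; rw [hwc] at h; have := hws a; omega
      · refine ⟨hab, ?_⟩
        rcases h with h | h
        · exact ⟨hWV h.1.1, h.2.1⟩
        · exact ⟨h.2.1, hWV h.1.1⟩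
    have h2 := Finset.card_le_card h1
    rw [Finset.card_union_of_disjoint, hcross] at h2
    · have hk := hρ2 (s - i) (by omega)
      have h3 := Finset.card_filter_add_card_filter_not (s := W.filter (fun v => ρ v < s - i))
        (fun v => dTo G v (V' \ W) = 0)
      have h4 : ((W.filter (fun v => ρ v < s - i)).filter (fun v => dTo G v (V' \ W) = 0)).card ≤
          (W.filter (fun v => dTo G v (V' \ W) = 0)).card :=
        Finset.card_le_card (Finset.filter_subset_filter _ (Finset.filter_subset _ _))
      have h5 : ((W.filter (fun v => ρ v < s - i)).filter (fun v => ¬ dTo G v (V' \ W) = 0)).card ≤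
          ∑ v ∈ W.filter (fun v => ρ v < s - i), dTo G v (V' \ W) := by
        rw [Finset.card_filter]
        apply Finset.sum_le_sum
        intro v _
        split_ifs <;> omega
      omega
    · rw [Finset.disjoint_left]
      intro e
      induction e with | _ a b =>
      simp only [mk_mem_eCr, Finset.mem_filter,
        SimpleGraph.mem_edgeFinset, SimpleGraph.mem_edgeSet, edgeWt_mk, Finset.mem_sdiff]
      rintro ⟨hab, h⟩ ⟨_, (⟨⟨h1, h2⟩, h3⟩ | ⟨⟨h1, h2⟩, h3⟩)⟩
      · rw [hwW a h1] at h; have := hws b; omega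
      · rw [hwW b h1] at h; have := hws a; omega
  · intro i hi
    have h1 : (G.edgeFinset.filter (fun e => edgeWt w e ≤ i)) ⊆
        eCr G {c} (W.filter (fun v => ρ v < i + 1)) ∪ eIn G W := by
      intro e
      induction e with | _ a b =>
      simp only [Finset.mem_union, mk_mem_eIn, mk_mem_eCr, Finset.mem_filter,
        SimpleGraph.mem_edgeFinset, SimpleGraph.mem_edgeSet, edgeWt_mk, Finset.mem_singleton]
      rintro ⟨hab, h⟩
      by_cases hac : a = c
      · subst hac
        rw [hwc] at h
        have hba : b ≠ a := hab.ne'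
        by_cases hbW : b ∈ W
        · rw [hwW b hbW] at h; left; exact ⟨hab, Or.inl ⟨rfl, hbW, by omega⟩⟩
        · rw [hwO b hba hbW] at h; omega
      by_cases hbc : b = c
      · subst hbc
        rw [hwc] at h
        by_cases haW : a ∈ W
        · rw [hwW a haW] at h; left; exact ⟨hab, Or.inr ⟨rfl, haW, by omega⟩⟩
        · rw [hwO a hac haW] at h; omega
      by_cases haW : a ∈ W <;> by_cases hbW : b ∈ W
      · tauto
      · rw [hwO b hbc hbW] at h; omega
      · rw [hwO a hac haW] at h; omega
      · rw [hwO a hac haW] at h; omega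
    have h2 := (Finset.card_le_card h1).trans (Finset.card_union_le _ _)
    have h3 := card_eCr_star G c (W.filter (fun v => ρ v < i + 1)) (by simp [hcnW])
      (fun v hv => hcW v (Finset.mem_filter.1 hv).1)
    rw [hρ2 (i + 1) (by omega)] at h3
    omega

theorem exists_third (A : Finset V) (x : ℕ) (hx : 3 * x ≤ A.card) (f : V → ℕ) :
    ∃ X ⊆ A, X.card = x ∧ 3 * ∑ v ∈ X, f v ≤ ∑ v ∈ A, f v := by
  obtain ⟨X1, h1, c1⟩ := Finset.exists_subset_card_eq (s := A) (n := x) (by omega)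
  have e1 := Finset.card_sdiff_of_subset h1
  obtain ⟨X2, h2, c2⟩ := Finset.exists_subset_card_eq (s := A \ X1) (n := x) (by omega)
  have e2 := Finset.card_sdiff_of_subset h2
  obtain ⟨X3, h3, c3⟩ := Finset.exists_subset_card_eq (s := (A \ X1) \ X2) (n := x) (by omega)
  have s1 := Finset.sum_sdiff h1 (f := f)
  have s2 := Finset.sum_sdiff h2 (f := f)
  have s3 := Finset.sum_sdiff h3 (f := f)
  by_cases g1 : 3 * ∑ v ∈ X1, f v ≤ ∑ v ∈ A, f v
  · exact ⟨X1, h1, c1, g1⟩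
  by_cases g2 : 3 * ∑ v ∈ X2, f v ≤ ∑ v ∈ A, f v
  · exact ⟨X2, h2.trans Finset.sdiff_subset, c2, g2⟩
  · exact ⟨X3, h3.trans (Finset.sdiff_subset.trans Finset.sdiff_subset), c3, by omega⟩

theorem exists_X {s x : ℕ} (hx : 3 * x ≤ s) (V' N : Finset V) (hN : N ⊆ V') (hNc : N.card = s)
    (h1 : s + 1 ≤ (eIn G V').card) (h2 : (eIn G V').card ≤ s + x + 1) :
    ∃ X ⊆ V', x ≤ (eIn G (V' \ X)).card ∧ (eIn G (V' \ X)).card ≤ s + 1 ∧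
      (eIn G X).card + 2 * x ≤ (eIn G V').card ∧ x ≤ (X ∩ N).card ∧ (X ∩ N).card ≤ 2 * x := by
  obtain ⟨X0, hX0, hc0, hs0⟩ := exists_third N x (by omega) (fun v => dTo G v V')
  have hs1 : ∑ v ∈ N, dTo G v V' ≤ ∑ v ∈ V', dTo G v V' :=
    Finset.sum_le_sum_of_subset hN
  rw [sum_dTo_self] at hs1
  have hX0V := hX0.trans hN
  have hd1 : (eIn G V').card = (eIn G X0).card + (eIn G (V' \ X0)).card +
      ∑ v ∈ X0, dTo G v (V' \ X0) := by
    rw [← card_eIn_union G Finset.disjoint_sdiff, Finset.union_sdiff_of_subset hX0V]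
  have hd2 : ∑ v ∈ X0, dTo G v V' = 2 * (eIn G X0).card + ∑ v ∈ X0, dTo G v (V' \ X0) := by
    rw [← sum_dTo_self, ← Finset.sum_add_distrib]
    refine Finset.sum_congr rfl fun v _ => ?_
    rw [← dTo_union G v Finset.disjoint_sdiff, Finset.union_sdiff_of_subset hX0V]
  have hi0 : X0 ∩ N = X0 := Finset.inter_eq_left.2 hX0
  by_cases hdone : (eIn G (V' \ X0)).card ≤ s + 1
  · refine ⟨X0, hX0V, by omega, hdone, by omega, ?_, ?_⟩ <;> rw [hi0] <;> omega
  push Not at hdone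
  set Fam := V'.powerset.filter (fun X => X0 ⊆ X ∧ s + 2 ≤ (eIn G (V' \ X)).card ∧
    X.card + (eIn G (V' \ X)).card ≤ x + (eIn G V').card) with hFam
  have hne : X0 ∈ Fam := by
    simp only [hFam, Finset.mem_filter, Finset.mem_powerset]
    exact ⟨hX0V, subset_rfl, by omega, by omega⟩
  obtain ⟨X, hX, hmax⟩ := Finset.exists_max_image Fam Finset.card ⟨X0, hne⟩
  simp only [hFam, Finset.mem_filter, Finset.mem_powerset] at hX
  obtain ⟨hXV, hX0X, hX2, hX3⟩ := hX
  -- a low degree end of an edge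
  have hlow : ∃ v ∈ V' \ X, 1 ≤ dTo G v (V' \ X) ∧
      2 * dTo G v (V' \ X) ≤ (eIn G (V' \ X)).card + 1 := by
    obtain ⟨e, he⟩ := Finset.card_pos.1 (show 0 < (eIn G (V' \ X)).card by omega)
    induction e with | _ a b =>
    rw [mk_mem_eIn] at he
    obtain ⟨hab, ha, hb⟩ := he
    have p1 := card_eIn_erase G ha
    have hb' : b ∈ (V' \ X).erase a := Finset.mem_erase.2 ⟨hab.ne', hb⟩
    have p2 := card_eIn_erase G hb'
    have p3 : dTo G b (V' \ X) ≤ dTo G b ((V' \ X).erase a) + 1 := by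
      have : (V' \ X) = {a} ∪ (V' \ X).erase a := by
        rw [← Finset.insert_eq, Finset.insert_erase ha]
      conv_lhs => rw [this]
      rw [dTo_union G b (by simp)]
      have : dTo G b {a} ≤ 1 := by
        unfold dTo
        exact (Finset.card_filter_le _ _).trans (by simp)
      omega
    have q1 : 1 ≤ dTo G a (V' \ X) :=
      Finset.card_pos.2 ⟨b, Finset.mem_filter.2 ⟨hb, hab⟩⟩
    have q2 : 1 ≤ dTo G b (V' \ X) :=
      Finset.card_pos.2 ⟨a, Finset.mem_filter.2 ⟨ha, hab.symm⟩⟩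
    rcases le_total (dTo G a (V' \ X)) (dTo G b (V' \ X)) with h | h
    · exact ⟨a, ha, q1, by omega⟩
    · exact ⟨b, hb, q2, by omega⟩
  obtain ⟨v, hv, hv1, hv2⟩ := hlow
  have hvV := (Finset.mem_sdiff.1 hv).1
  have hvX := (Finset.mem_sdiff.1 hv).2
  have herase : V' \ insert v X = (V' \ X).erase v := by
    ext u; simp only [Finset.mem_sdiff, Finset.mem_insert, Finset.mem_erase]; tauto
  have hrem := card_eIn_erase G hv
  rw [← herase] at hrem
  have hcard := Finset.card_insert_of_notMem hvX
  have hnot : (eIn G (V' \ insert v X)).card ≤ s + 1 := by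
    by_contra hcon
    have := hmax (insert v X) (by
      simp only [hFam, Finset.mem_filter, Finset.mem_powerset]
      exact ⟨Finset.insert_subset hvV hXV, hX0X.trans (Finset.subset_insert _ _), by omega, by omega⟩)
    omega
  have hin : (eIn G (insert v X)).card + (eIn G (V' \ X)).card ≤ (eIn G V').card := by
    rw [← Finset.card_union_of_disjoint]
    · exact Finset.card_le_card (Finset.union_subset
        (eIn_mono G (Finset.insert_subset hvV hXV)) (eIn_mono G Finset.sdiff_subset))
    · rw [Finset.disjoint_left]
      intro e
      induction e with | _ a b =>
      simp only [mk_mem_eIn, Finset.mem_insert, Finset.mem_sdiff]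
      rintro ⟨hab, ha, hb⟩ ⟨_, ha', hb'⟩
      have : a = v := by tauto
      have : b = v := by tauto
      exact hab.ne (by simp [*])
  have hsub : X0 ⊆ insert v X ∩ N :=
    Finset.subset_inter (hX0X.trans (Finset.subset_insert _ _)) hX0
  have hl := Finset.card_le_card hsub
  have hu := Finset.card_le_card (Finset.inter_subset_left (s₁ := insert v X) (s₂ := N))
  exact ⟨insert v X, Finset.insert_subset hvV hXV, by omega, hnot, by omega, by omega, by omega⟩

end RegimeOneB


section RegimeOneC

variable {V : Type*} [Fintype V] [DecidableEq V] (G : SimpleGraph V) [DecidableRel G.Adj]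

theorem regime1_zeros {s x : ℕ} (hs : 100 ≤ s) (hx : 3 * x ≤ s) (hm : G.edgeFinset.card = 3 * s + 1)
    (c : V) (V' N : Finset V) (hV' : V' = Finset.univ.erase c)
    (hN : ∀ v, v ∈ N ↔ G.Adj c v) (hNc : N.card + x = 2 * s)
    (hr : (eIn G V').card = s + 1 + x) (W : Finset V) (hWN : W ⊆ N)
    (hWx : (eIn G W).card ≤ x)
    (hz : s - x ≤ (W.filter (fun v => dTo G v (V' \ W) = 0)).card) :
    ∃ w : V → ℕ, (∀ v, w v ≤ s) ∧ WellGuarded G s w := by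
  have hmV : ∀ v, v ∈ V' ↔ v ≠ c := by intro v; rw [hV']; simp
  obtain ⟨T, hT, hTc⟩ := Finset.exists_subset_card_eq hz
  have hTW : T ⊆ W := hT.trans (Finset.filter_subset _ _)
  have hTN : T ⊆ N := hTW.trans hWN
  have hcN : c ∉ N := fun h => G.irrefl ((hN c).1 h)
  have hNV : N ⊆ V' := fun v hv => (hmV v).2 (by rintro rfl; exact hcN hv)
  set V2 := V' \ T with hV2
  have hmV2 : ∀ v, v ∈ V2 ↔ v ≠ c ∧ v ∉ T := by
    intro v; rw [hV2, Finset.mem_sdiff, hmV]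
  have hjunk : eIn G V' ⊆ eIn G V2 ∪ eIn G W := by
    have key : ∀ a b, G.Adj a b → a ∈ T → b ∈ V' → b ∈ W := by
      intro a b hab ha hb
      by_contra hbW
      have h0 := (Finset.mem_filter.1 (hT ha)).2
      unfold dTo at h0
      rw [Finset.card_eq_zero, Finset.filter_eq_empty_iff] at h0
      exact h0 (Finset.mem_sdiff.2 ⟨hb, hbW⟩) hab
    intro e
    induction e with | _ a b =>
    simp only [Finset.mem_union, mk_mem_eIn, hV2, Finset.mem_sdiff]
    rintro ⟨hab, ha, hb⟩
    by_cases haT : a ∈ T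
    · right; exact ⟨hab, hTW haT, key a b hab haT hb⟩
    by_cases hbT : b ∈ T
    · right; exact ⟨hab, key b a hab.symm hbT ha, hTW hbT⟩
    left; exact ⟨hab, ⟨ha, haT⟩, ⟨hb, hbT⟩⟩
  have hj1 := (Finset.card_le_card hjunk).trans (Finset.card_union_le _ _)
  have hj2 : (eIn G V2).card ≤ (eIn G V').card :=
    Finset.card_le_card (eIn_mono G Finset.sdiff_subset)
  have hj3 := Finset.card_sdiff_of_subset (eIn_mono G (Finset.sdiff_subset : V2 ⊆ V'))
  have hN2 := Finset.card_sdiff_of_subset hTN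
  obtain ⟨X, hXV, hX1, hX2, hX3, hX4, hX5⟩ := exists_X G hx V2 (N \ T)
    (Finset.sdiff_subset_sdiff hNV subset_rfl) (by omega) (by omega) (by omega)
  obtain ⟨ρ, hρ1, hρ2, -⟩ := exists_rank T (fun _ => 0)
  rw [hTc] at hρ1 hρ2
  have hXT : ∀ v ∈ X, v ∉ T := fun v hv => ((hmV2 v).1 (hXV hv)).2
  have hXc : ∀ v ∈ X, v ≠ c := fun v hv => ((hmV2 v).1 (hXV hv)).1
  have hTcc : ∀ v ∈ T, v ≠ c := fun v hv => by rintro rfl; exact hcN (hTN hv)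
  set w : V → ℕ := fun v => if v = c then 0 else if v ∈ T then ρ v else if v ∈ X then s - x else s with hw
  have hwc : w c = 0 := by simp [hw]
  have hwT : ∀ v ∈ T, w v = ρ v := fun v hv => by simp [hw, hTcc v hv, hv]
  have hwX : ∀ v ∈ X, w v = s - x := fun v hv => by simp [hw, hXc v hv, hXT v hv, hv]
  have hwO : ∀ v, v ≠ c → v ∉ T → v ∉ X → w v = s := fun v h1 h2 h3 => by simp [hw, h1, h2, h3]
  have hws : ∀ v, w v ≤ s := by
    intro v
    by_cases h1 : v = c
    · rw [h1, hwc]; omega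
    by_cases h2 : v ∈ T
    · rw [hwT v h2]; have := hρ1 v h2; omega
    by_cases h3 : v ∈ X
    · rw [hwX v h3]; omega
    rw [hwO v h1 h2 h3]
  have hwV2 : ∀ v ∈ V2, s - x ≤ w v := by
    intro v hv
    by_cases h3 : v ∈ X
    · rw [hwX v h3]
    · rw [hwO v ((hmV2 v).1 hv).1 ((hmV2 v).1 hv).2 h3]; omega
  set XN := X ∩ (N \ T) with hXN
  have hstar1 : ∀ i < s - x, (eCr G {c} (T.filter (fun v => ρ v < i + 1))).card = i + 1 := by
    intro i hi
    rw [card_eCr_star G c _ (fun h => hTcc c (Finset.mem_filter.1 h).1 rfl)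
      (fun v hv => (hN v).1 (hTN (Finset.mem_filter.1 hv).1))]
    exact hρ2 (i + 1) (by omega)
  have hstar2 : (eCr G {c} (T ∪ XN)).card = s - x + XN.card := by
    rw [card_eCr_star G c, Finset.card_union_of_disjoint, hTc]
    · rw [Finset.disjoint_left]
      intro v hv hv2
      exact hXT v (Finset.mem_inter.1 hv2).1 hv
    · intro h
      rcases Finset.mem_union.1 h with h | h
      · exact hTcc c h rfl
      · exact hXc c (Finset.mem_inter.1 h).1 rfl
    · intro v h
      rcases Finset.mem_union.1 h with h | h
      · exact (hN v).1 (hTN h)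
      · exact (hN v).1 (Finset.mem_sdiff.1 (Finset.mem_inter.1 h).2).1
  refine wg_crit G hm w hws ?_ ?_ ?_ ?_
  · intro i hi
    rcases lt_or_ge i (s - x) with h | h
    · rw [← hstar1 i h]
      apply Finset.card_le_card
      intro e
      induction e with | _ a b =>
      rw [mk_mem_eCr]
      simp only [Finset.mem_singleton, Finset.mem_filter, SimpleGraph.mem_edgeFinset,
        SimpleGraph.mem_edgeSet, edgeWt_mk]
      rintro ⟨hab, (⟨rfl, h2, h3⟩ | ⟨rfl, h2, h3⟩)⟩
      · refine ⟨hab, ?_⟩; rw [hwc, hwT _ h2]; omega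
      · refine ⟨hab, ?_⟩; rw [hwc, hwT _ h2]; omega
    · have : i + 1 ≤ (eCr G {c} (T ∪ XN)).card := by omega
      refine this.trans (Finset.card_le_card ?_)
      have key : ∀ v ∈ T ∪ XN, w v ≤ i := by
        intro v h
        rcases Finset.mem_union.1 h with h | h
        · rw [hwT v h]; have := hρ1 v h; omega
        · rw [hwX v (Finset.mem_inter.1 h).1]; omega
      intro e
      induction e with | _ a b =>
      rw [mk_mem_eCr]
      simp only [Finset.mem_singleton, Finset.mem_filter, SimpleGraph.mem_edgeFinset,
        SimpleGraph.mem_edgeSet, edgeWt_mk]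
      rintro ⟨hab, (⟨rfl, h2⟩ | ⟨rfl, h2⟩)⟩
      · refine ⟨hab, ?_⟩; rw [hwc]; have := key _ h2; omega
      · refine ⟨hab, ?_⟩; rw [hwc]; have := key _ h2; omega
  · intro i hi
    have key : ∀ F : Finset (Sym2 V), i + 1 ≤ F.card →
        (∀ a b, s(a, b) ∈ F → G.Adj a b ∧ 2 * s - i ≤ w a + w b) →
        i + 1 ≤ (G.edgeFinset.filter (fun e => 2 * s - i ≤ edgeWt w e)).card := by
      intro F h1 h2
      refine h1.trans (Finset.card_le_card ?_)
      intro e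
      induction e with | _ a b =>
      intro h
      simp only [Finset.mem_filter, SimpleGraph.mem_edgeFinset,
        SimpleGraph.mem_edgeSet, edgeWt_mk]
      exact h2 a b h
    rcases lt_or_ge i x with h | h
    · apply key (eIn G (V2 \ X)) (by omega)
      intro a b hab
      rw [mk_mem_eIn] at hab
      obtain ⟨hab, ha, hb⟩ := hab
      have a3 := (Finset.mem_sdiff.1 ha).2
      have b3 := (Finset.mem_sdiff.1 hb).2
      obtain ⟨a1, a2⟩ := (hmV2 a).1 (Finset.mem_sdiff.1 ha).1
      obtain ⟨b1, b2⟩ := (hmV2 b).1 (Finset.mem_sdiff.1 hb).1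
      refine ⟨hab, ?_⟩
      rw [hwO a a1 a2 a3, hwO b b1 b2 b3]; omega
    rcases lt_or_ge i (2 * x) with h' | h'
    · have := Finset.card_sdiff_of_subset (eIn_mono G hXV)
      apply key (eIn G V2 \ eIn G X) (by omega)
      intro a b hab
      rw [Finset.mem_sdiff, mk_mem_eIn, mk_mem_eIn] at hab
      obtain ⟨⟨hab, ha, hb⟩, hn⟩ := hab
      refine ⟨hab, ?_⟩
      have ha2 := hwV2 a ha
      have hb2 := hwV2 b hb
      by_cases haX : a ∈ X
      · have hbX : b ∉ X := by tauto
        rw [hwO b ((hmV2 b).1 hb).1 ((hmV2 b).1 hb).2 hbX]; omega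
      · rw [hwO a ((hmV2 a).1 ha).1 ((hmV2 a).1 ha).2 haX]; omega
    · apply key (eIn G V2) (by omega)
      intro a b hab
      rw [mk_mem_eIn] at hab
      obtain ⟨hab, ha, hb⟩ := hab
      refine ⟨hab, ?_⟩
      have ha2 := hwV2 a ha
      have hb2 := hwV2 b hb
      omega
  · intro i hi
    have hnc : ∀ a b, 2 * s - i ≤ w a + w b → a ≠ c ∧ b ≠ c := by
      intro a b h
      constructor
      · rintro rfl; rw [hwc] at h; have := hws b; omega
      · rintro rfl; rw [hwc] at h; have := hws a; omega
    rcases lt_or_ge i x with h | h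
    · have : G.edgeFinset.filter (fun e => 2 * s - i ≤ edgeWt w e) ⊆ eIn G (V2 \ X) := by
        intro e
        induction e with | _ a b =>
        simp only [Finset.mem_filter, SimpleGraph.mem_edgeFinset,
          SimpleGraph.mem_edgeSet, edgeWt_mk, mk_mem_eIn, Finset.mem_sdiff, hmV2]
        rintro ⟨hab, hle⟩
        obtain ⟨a1, b1⟩ := hnc a b hle
        have hsa := hws a
        have hsb := hws b
        refine ⟨hab, ⟨⟨a1, ?_⟩, ?_⟩, ⟨⟨b1, ?_⟩, ?_⟩⟩
        · intro hh; have := hwT a hh; have := hρ1 a hh; omega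
        · intro hh; have := hwX a hh; omega
        · intro hh; have := hwT b hh; have := hρ1 b hh; omega
        · intro hh; have := hwX b hh; omega
      have := Finset.card_le_card this
      omega
    · have : G.edgeFinset.filter (fun e => 2 * s - i ≤ edgeWt w e) ⊆ eIn G V' := by
        intro e
        induction e with | _ a b =>
        simp only [Finset.mem_filter, SimpleGraph.mem_edgeFinset,
          SimpleGraph.mem_edgeSet, edgeWt_mk, mk_mem_eIn, hmV]
        rintro ⟨hab, hle⟩
        exact ⟨hab, hnc a b hle⟩
      have := Finset.card_le_card this
      omega
  · intro i hi
    have hgen : ∀ B : Finset V, (∀ v ∈ N, w v ≤ i → v ∈ B) →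
        (G.edgeFinset.filter (fun e => edgeWt w e ≤ i)) ⊆
          eCr G {c} B ∪ (eIn G V' \ eIn G V2) := by
      intro B hB e
      induction e with | _ a b =>
      simp only [Finset.mem_union, Finset.mem_sdiff, mk_mem_eIn, mk_mem_eCr, Finset.mem_filter,
        SimpleGraph.mem_edgeFinset, SimpleGraph.mem_edgeSet, edgeWt_mk, Finset.mem_singleton, hmV]
      rintro ⟨hab, h⟩
      by_cases hac : a = c
      · left; refine ⟨hab, Or.inl ⟨hac, hB b ((hN b).2 (hac ▸ hab)) (by omega)⟩⟩
      by_cases hbc : b = c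
      · left; refine ⟨hab, Or.inr ⟨hbc, hB a ((hN a).2 (hbc ▸ hab.symm)) (by omega)⟩⟩
      right
      refine ⟨⟨hab, hac, hbc⟩, ?_⟩
      rintro ⟨_, ha, hb⟩
      have ha2 := hwV2 a ha
      have hb2 := hwV2 b hb
      omega
    rcases lt_or_ge i (s - x) with h | h
    · have h1 := hgen (T.filter (fun v => ρ v < i + 1)) (by
        intro v hv hvi
        have hvc : v ≠ c := by rintro rfl; exact hcN hv
        by_cases hvT : v ∈ T
        · rw [hwT v hvT] at hvi
          exact Finset.mem_filter.2 ⟨hvT, by omega⟩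
        · have := hwV2 v ((hmV2 v).2 ⟨hvc, hvT⟩)
          omega)
      have h2 := (Finset.card_le_card h1).trans (Finset.card_union_le _ _)
      rw [hstar1 i h] at h2
      have hj4 : (eIn G V' \ eIn G V2).card = (eIn G V').card - (eIn G V2).card := hj3
      omega
    · have h1 := hgen (T ∪ XN) (by
        intro v hv hvi
        have hvc : v ≠ c := by rintro rfl; exact hcN hv
        rw [Finset.mem_union]
        by_cases hvT : v ∈ T
        · left; exact hvT
        · right
          rw [hXN, Finset.mem_inter, Finset.mem_sdiff]
          refine ⟨?_, hv, hvT⟩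
          by_contra hvX
          rw [hwO v hvc hvT hvX] at hvi
          omega)
      have h2 := (Finset.card_le_card h1).trans (Finset.card_union_le _ _)
      rw [hstar2] at h2
      have hj4 : (eIn G V' \ eIn G V2).card = (eIn G V').card - (eIn G V2).card := hj3
      omega

theorem regime1 {s : ℕ} (hs : 100 ≤ s) (hm : G.edgeFinset.card = 3 * s + 1) (c : V)
    (h1 : G.degree c ≤ 2 * s) (h2 : 5 * s ≤ 3 * G.degree c) :
    ∃ w : V → ℕ, (∀ v, w v ≤ s) ∧ WellGuarded G s w := by
  obtain ⟨x, hx⟩ : ∃ x, G.degree c + x = 2 * s := ⟨2 * s - G.degree c, by omega⟩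
  have hr := card_eIn_erase G (Finset.mem_univ c)
  rw [eIn_univ, dTo_univ, hm] at hr
  have hNc : (G.neighborFinset c).card + x = 2 * s := by
    rw [SimpleGraph.card_neighborFinset_eq_degree]; exact hx
  have hNV : G.neighborFinset c ⊆ Finset.univ.erase c := by
    intro v hv
    rw [SimpleGraph.mem_neighborFinset] at hv
    simp [hv.ne']
  obtain ⟨W, hWN, hWc, hWx, hW1⟩ := exists_W G hs (x := x) (by omega) _ _ hNV hNc (by omega)
  by_cases hz : (W.filter (fun v => dTo G v (Finset.univ.erase c \ W) = 0)).card ≤ s - x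
  · exact regime1_main G (x := x) (by omega) hm c _ rfl (by omega) W
      (fun v hv => by simpa using hWN hv) hWc hWx hW1 hz
  · exact regime1_zeros G hs (x := x) (by omega) hm c _ (G.neighborFinset c) rfl
      (fun v => by simp) hNc (by omega) W hWN hWx (by omega)

end RegimeOneC

/-! ### three stars -/
section RegimeThree
variable {V : Type*} [Fintype V] [DecidableEq V] (G : SimpleGraph V) [DecidableRel G.Adj]

theorem dTo_eq_zero {v : V} {B : Finset V} : dTo G v B = 0 ↔ ∀ u ∈ B, ¬ G.Adj v u := by
  unfold dTo
  rw [Finset.card_eq_zero, Finset.filter_eq_empty_iff]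

theorem dTo_le_card (v : V) (B : Finset V) : dTo G v B ≤ B.card :=
  Finset.card_le_card (Finset.filter_subset _ _)

theorem eIn_card_zero {A : Finset V} (h : ∀ x ∈ A, ∀ y ∈ A, ¬ G.Adj x y) :
    (eIn G A).card = 0 := by
  rw [Finset.card_eq_zero, Finset.eq_empty_iff_forall_notMem]
  intro e
  induction e with | _ x y =>
  rw [mk_mem_eIn]
  rintro ⟨h1, h2, h3⟩
  exact h x h2 y h3 h1

theorem glue {s z : ℕ} (hm : G.edgeFinset.card = 3 * s + 1) (S F B : Finset V)
    (hSF : Disjoint S F) (hSB : Disjoint S B) (hFB : Disjoint F B)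
    (hcov : ∀ v, v ∈ S ∨ v ∈ F ∨ v ∈ B)
    (hFi : ∀ x ∈ F, ∀ y ∈ F, ¬ G.Adj x y)
    (hFS : ∀ f ∈ F, dTo G f S = 1) (hF2 : ∀ f ∈ F, dTo G f B ≤ 2)
    (hFz : F.card + z = s) (hz1 : z ≤ (eIn G S).card) (hz2 : (eIn G S).card ≤ s)
    (hB1 : 1 ≤ (eIn G B).card) (hBs : s ≤ (eIn G B).card + ∑ f ∈ F, dTo G f B)
    (hB2 : (eIn G B).card ≤ 2 ∨ (eIn G B).card + ∑ f ∈ F, dTo G f B ≤ s + 1) :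
    ∃ w : V → ℕ, (∀ v, w v ≤ s) ∧ WellGuarded G s w := by
  obtain ⟨ρ, hρ1, hρ2, hρ3⟩ := exists_rank F (fun v => dTo G v B)
  have dSF := Finset.disjoint_left.1 hSF
  have dSB := Finset.disjoint_left.1 hSB
  have dFB := Finset.disjoint_left.1 hFB
  set w : V → ℕ := fun v => if v ∈ S then 0 else if v ∈ F then z + ρ v else s with hw
  have hwS : ∀ v ∈ S, w v = 0 := fun v hv => by simp [hw, hv]
  have hwF : ∀ v ∈ F, w v = z + ρ v := fun v hv => by
    have : v ∉ S := fun h => dSF h hv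
    simp [hw, hv, this]
  have hwB : ∀ v ∈ B, w v = s := fun v hv => by
    have h1 : v ∉ S := fun h => dSB h hv
    have h2 : v ∉ F := fun h => dFB h hv
    simp [hw, h1, h2]
  have hwF' : ∀ v ∈ F, w v < s := fun v hv => by rw [hwF v hv]; have := hρ1 v hv; omega
  have hws : ∀ v, w v ≤ s := by
    intro v
    rcases hcov v with h | h | h
    · rw [hwS v h]; omega
    · exact (hwF' v h).le
    · rw [hwB v h]
  have dis : ∀ (P : V → Prop) [DecidablePred P] (C : Finset V), Disjoint F C →
      Disjoint (eIn G C) (eCr G (F.filter P) C) := by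
    intro P _ C hC
    have dC := Finset.disjoint_left.1 hC
    rw [Finset.disjoint_left]
    intro e
    induction e with | _ x y =>
    rw [mk_mem_eIn, mk_mem_eCr]
    rintro ⟨h1, h2, h3⟩ ⟨_, (⟨h4, h5⟩ | ⟨h4, h5⟩)⟩
    · exact dC (Finset.mem_filter.1 h4).1 h2
    · exact dC (Finset.mem_filter.1 h4).1 h3
  -- low counts
  have low : ∀ i < s, (G.edgeFinset.filter (fun e => edgeWt w e ≤ i)).card =
      (eIn G S).card + (i + 1 - z) := by
    intro i hi
    have h1 : G.edgeFinset.filter (fun e => edgeWt w e ≤ i) =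
        eIn G S ∪ eCr G (F.filter (fun x => ρ x < i + 1 - z)) S := by
      ext e
      induction e with | _ x y =>
      simp only [Finset.mem_union, mk_mem_eIn, mk_mem_eCr, Finset.mem_filter,
        SimpleGraph.mem_edgeFinset, SimpleGraph.mem_edgeSet, edgeWt_mk]
      constructor
      · rintro ⟨hab, hle⟩
        rcases hcov x with hx | hx | hx <;> rcases hcov y with hy | hy | hy
        · exact Or.inl ⟨hab, hx, hy⟩
        · rw [hwF y hy] at hle
          exact Or.inr ⟨hab, Or.inr ⟨⟨hy, by omega⟩, hx⟩⟩
        · rw [hwB y hy] at hle; omega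
        · rw [hwF x hx] at hle
          exact Or.inr ⟨hab, Or.inl ⟨⟨hx, by omega⟩, hy⟩⟩
        · exact absurd hab (hFi x hx y hy)
        · rw [hwB y hy] at hle; omega
        · rw [hwB x hx] at hle; omega
        · rw [hwB x hx] at hle; omega
        · rw [hwB x hx] at hle; omega
      · rintro (⟨hab, hx, hy⟩ | ⟨hab, (⟨⟨hx, h⟩, hy⟩ | ⟨⟨hx, h⟩, hy⟩)⟩)
        · refine ⟨hab, ?_⟩; rw [hwS x hx, hwS y hy]; omega
        · refine ⟨hab, ?_⟩; rw [hwF x hx, hwS y hy]; omega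
        · refine ⟨hab, ?_⟩; rw [hwF y hx, hwS x hy]; omega
    rw [h1, Finset.card_union_of_disjoint (dis _ S hSF.symm),
      card_eCr G
        (Finset.disjoint_of_subset_left (Finset.filter_subset _ _) hSF.symm),
      Finset.sum_congr rfl (fun f hf => hFS f (Finset.mem_filter.1 hf).1)]
    rw [Finset.sum_const, smul_eq_mul, mul_one, hρ2 _ (by omega)]
  have high : ∀ i < s, (G.edgeFinset.filter (fun e => 2 * s - i ≤ edgeWt w e)).card =
      (eIn G B).card + ∑ f ∈ F.filter (fun x => s ≤ z + ρ x + i), dTo G f B := by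
    intro i hi
    have h1 : G.edgeFinset.filter (fun e => 2 * s - i ≤ edgeWt w e) =
        eIn G B ∪ eCr G (F.filter (fun x => s ≤ z + ρ x + i)) B := by
      ext e
      induction e with | _ x y =>
      simp only [Finset.mem_union, mk_mem_eIn, mk_mem_eCr, Finset.mem_filter,
        SimpleGraph.mem_edgeFinset, SimpleGraph.mem_edgeSet, edgeWt_mk]
      constructor
      · rintro ⟨hab, hle⟩
        have hx' := hws x
        have hy' := hws y
        rcases hcov x with hx | hx | hx <;> rcases hcov y with hy | hy | hy
        · rw [hwS x hx] at hle; omega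
        · rw [hwS x hx] at hle; omega
        · rw [hwS x hx] at hle; omega
        · rw [hwS y hy] at hle; omega
        · exact absurd hab (hFi x hx y hy)
        · rw [hwF x hx, hwB y hy] at hle
          exact Or.inr ⟨hab, Or.inl ⟨⟨hx, by omega⟩, hy⟩⟩
        · rw [hwS y hy] at hle; omega
        · rw [hwF y hy, hwB x hx] at hle
          exact Or.inr ⟨hab, Or.inr ⟨⟨hy, by omega⟩, hx⟩⟩
        · exact Or.inl ⟨hab, hx, hy⟩
      · rintro (⟨hab, hx, hy⟩ | ⟨hab, (⟨⟨hx, h⟩, hy⟩ | ⟨⟨hx, h⟩, hy⟩)⟩)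
        · refine ⟨hab, ?_⟩; rw [hwB x hx, hwB y hy]; omega
        · refine ⟨hab, ?_⟩; rw [hwF x hx, hwB y hy]; omega
        · refine ⟨hab, ?_⟩; rw [hwF y hx, hwB x hy]; omega
    rw [h1, Finset.card_union_of_disjoint (dis _ B hFB),
      card_eCr G (Finset.disjoint_of_subset_left (Finset.filter_subset _ _) hFB)]
  have hcard : ∀ i ≤ F.card, (F.filter (fun x => s ≤ z + ρ x + i)).card = i := by
    intro i hi
    have h1 := Finset.card_filter_add_card_filter_not (s := F) (fun x => ρ x < F.card - i)
    rw [hρ2 _ (by omega)] at h1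
    have h2 : F.filter (fun x => s ≤ z + ρ x + i) = F.filter (fun x => ¬ ρ x < F.card - i) := by
      apply Finset.filter_congr
      intro x hx
      omega
    rw [h2]; omega
  have hle : ∀ i, ∑ f ∈ F.filter (fun x => s ≤ z + ρ x + i), dTo G f B ≤ ∑ f ∈ F, dTo G f B :=
    fun i => Finset.sum_le_sum_of_subset (Finset.filter_subset _ _)
  refine wg_crit G hm w hws ?_ ?_ ?_ ?_
  · intro i hi; rw [low i hi]; omega
  · intro i hi; rw [high i hi]
    by_cases hall : ∀ f ∈ F.filter (fun x => s ≤ z + ρ x + i), 1 ≤ dTo G f B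
    · rcases lt_or_ge i F.card with h | h
      · have := Finset.card_nsmul_le_sum _ (fun f => dTo G f B) 1 hall
        rw [hcard i h.le] at this
        simp only [smul_eq_mul, mul_one] at this
        omega
      · have : F.filter (fun x => s ≤ z + ρ x + i) = F :=
          Finset.filter_true_of_mem (fun x hx => by omega)
        rw [this]; omega
    · push Not at hall
      obtain ⟨f, hf, hf0⟩ := hall
      rw [Finset.mem_filter] at hf
      have : ∑ f ∈ F.filter (fun x => s ≤ z + ρ x + i), dTo G f B = ∑ f ∈ F, dTo G f B := by
        apply Finset.sum_subset (Finset.filter_subset _ _)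
        intro x hx hx'
        rw [Finset.mem_filter] at hx'
        have : ρ x < ρ f := by
          by_contra hh; exact hx' ⟨hx, by omega⟩
        have := hρ3 x hx f hf.1 this
        omega
      rw [this]; omega
  · intro i hi; rw [high i hi]
    rcases hB2 with h | h
    · rcases lt_or_ge i F.card with h' | h'
      · have := Finset.sum_le_card_nsmul (F.filter (fun x => s ≤ z + ρ x + i))
          (fun f => dTo G f B) 2 (fun f hf => hF2 f (Finset.mem_filter.1 hf).1)
        rw [hcard i h'.le, smul_eq_mul] at this
        omega
      · have := Finset.sum_le_card_nsmul F
          (fun f => dTo G f B) 2 (fun f hf => hF2 f hf)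
        rw [smul_eq_mul] at this
        have := hle i
        omega
    · have := hle i; omega
  · intro i hi; rw [low i hi]; omega

set_option maxHeartbeats 2000000 in
theorem regime3_core {s : ℕ} (hm : G.edgeFinset.card = 3 * s + 1) (a b c : V)
    (hab : a ≠ b) (hac : a ≠ c) (hbc : b ≠ c) (V' : Finset V)
    (hV' : V' = Finset.univ \ {a, b, c})
    (hc1 : s + 1 ≤ dTo G c V' + (eIn G V').card + (eIn G {a, b}).card)
    (hc2 : dTo G c V' + 4 * (eIn G V').card ≤ 2 * s)
    (hab4 : s + 4 * (eIn G V').card ≤ dTo G a V' + dTo G b V')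
    (hr : 3 * (eIn G V').card ≤ s) (hs : 1 ≤ s) :
    ∃ w : V → ℕ, (∀ v, w v ≤ s) ∧ WellGuarded G s w := by
  have hmV : ∀ v, v ∈ V' ↔ v ≠ a ∧ v ≠ b ∧ v ≠ c := by intro v; rw [hV']; simp
  set r := (eIn G V').card with hrdef
  set U := V'.filter (fun v => dTo G v V' ≠ 0) with hU
  have hU2 : U.card ≤ 2 * r := by
    rw [hrdef, ← sum_dTo_self]
    have h1 : U.card • 1 ≤ ∑ v ∈ U, dTo G v V' := Finset.card_nsmul_le_sum _ _ _ (fun v hv => by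
      have := (Finset.mem_filter.1 hv).2; omega)
    rw [smul_eq_mul, mul_one] at h1
    exact h1.trans (Finset.sum_le_sum_of_subset (Finset.filter_subset _ _))
  set P := V' \ U with hP
  have hUV : U ⊆ V' := Finset.filter_subset _ _
  have hPV : P ⊆ V' := Finset.sdiff_subset
  have hPU : V' = P ∪ U := (Finset.sdiff_union_of_subset hUV).symm
  have dPU : Disjoint P U := Finset.sdiff_disjoint
  have hP0 : ∀ p ∈ P, ∀ v ∈ V', ¬ G.Adj p v := by
    intro p hp v hv
    rw [hP, Finset.mem_sdiff, hU, Finset.mem_filter] at hp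
    have h0 : dTo G p V' = 0 := by by_contra h; exact hp.2 ⟨hp.1, h⟩
    exact (dTo_eq_zero G).1 h0 v hv
  have hP0' : ∀ p ∈ P, ∀ A ⊆ V', dTo G p A = 0 := fun p hp A hA =>
    (dTo_eq_zero G).2 (fun u hu => hP0 p hp u (hA hu))
  -- masses
  have hmass : s ≤ ∑ p ∈ P, dTo G p {a, b} := by
    have e1 := card_eCr G (A := V') (B := {a, b}) (by
      rw [Finset.disjoint_left]; intro v hv; have := (hmV v).1 hv; simp; tauto)
    have e2 := card_eIn_union G (A := V') (B := {a, b}) (by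
      rw [Finset.disjoint_left]; intro v hv; have := (hmV v).1 hv; simp; tauto)
    have e3 := card_eIn_union G (A := {a, b}) (B := V') (by
      rw [Finset.disjoint_right]; intro v hv; have := (hmV v).1 hv; simp; tauto)
    rw [Finset.union_comm, e2, Finset.sum_pair hab] at e3
    have e4 : ∑ v ∈ V', dTo G v {a, b} = ∑ p ∈ P, dTo G p {a, b} + ∑ p ∈ U, dTo G p {a, b} := by
      conv_lhs => rw [hPU]
      exact Finset.sum_union dPU
    have e5 : ∑ p ∈ U, dTo G p {a, b} ≤ U.card • 2 := Finset.sum_le_card_nsmul _ _ _ (fun v _ =>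
      (dTo_le_card G v _).trans Finset.card_le_two)
    rw [smul_eq_mul] at e5
    omega
  set M := P.filter (fun v => G.Adj c v) with hM
  have hcU : dTo G c V' = M.card + dTo G c U := by
    conv_lhs => rw [hPU]
    rw [dTo_union G c dPU]; rfl
  set z := r + dTo G c U with hz
  have hzU : (eIn G (insert c U)).card = z := by
    have hcn : c ∉ U := fun h => ((hmV c).1 (hUV h)).2.2 rfl
    rw [card_eIn_insert G hcn]
    have := card_eIn_union G dPU
    rw [← hPU, eIn_card_zero G (fun x hx y hy => hP0 x hx y (hPV hy)),
      Finset.sum_eq_zero (fun p hp => hP0' p hp U hUV)] at this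
    omega
  have hcU2 := dTo_le_card G c U
  have hβ2 : ∀ v, dTo G v {a, b} ≤ 2 := fun v => (dTo_le_card G v _).trans Finset.card_le_two
  -- choose X0 and F
  obtain ⟨X0, F, hX0P, hFM, hd0, hFc, hX01, hX02⟩ : ∃ X0 F : Finset V, X0 ⊆ P ∧ F ⊆ M ∧
      Disjoint X0 F ∧ F.card = s - z ∧ 1 ≤ (eIn G {a, b}).card + ∑ p ∈ X0, dTo G p {a, b} ∧
      (eIn G {a, b}).card + ∑ p ∈ X0, dTo G p {a, b} ≤ 2 := by
    have hle1 : (eIn G {a, b}).card ≤ 1 := by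
      rw [card_eIn_insert G (by simpa using hab), eIn_singleton]
      have := dTo_le_card G a {b}
      simpa using this
    rcases Nat.eq_zero_or_pos (eIn G {a, b}).card with h0 | h0
    · obtain ⟨v0, hv0, hv1⟩ : ∃ v ∈ P, 1 ≤ dTo G v {a, b} := by
        by_contra! hh
        have : ∑ p ∈ P, dTo G p {a, b} = 0 := Finset.sum_eq_zero (fun p hp => by
          have := hh p hp; omega)
        omega
      have : s - z ≤ (M.erase v0).card := by
        have := Finset.pred_card_le_card_erase (s := M) (a := v0)
        omega
      obtain ⟨F, hF, hFc⟩ := Finset.exists_subset_card_eq this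
      refine ⟨{v0}, F, by simpa using hv0, hF.trans (Finset.erase_subset _ _), ?_, hFc, ?_, ?_⟩
      · rw [Finset.disjoint_singleton_left]
        intro h; have := hF h; simp at this
      · rw [Finset.sum_singleton]; omega
      · rw [Finset.sum_singleton]; have := hβ2 v0; omega
    · have : s - z ≤ M.card := by omega
      obtain ⟨F, hF, hFc⟩ := Finset.exists_subset_card_eq this
      exact ⟨∅, F, by simp, hF, by simp, hFc, by rw [Finset.sum_empty]; omega, by rw [Finset.sum_empty]; omega⟩
  have hFP : F ⊆ P := hFM.trans (Finset.filter_subset _ _)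
  -- minimal X
  set BF := ∑ p ∈ F, dTo G p {a, b} with hBF
  set μ := (eIn G {a, b}).card with hμ
  obtain ⟨X, hXP, hXF, hX1, hXs, hX2⟩ : ∃ X ⊆ P, Disjoint X F ∧
      1 ≤ μ + ∑ p ∈ X, dTo G p {a, b} ∧ s ≤ μ + ∑ p ∈ X, dTo G p {a, b} + BF ∧
      (μ + ∑ p ∈ X, dTo G p {a, b} ≤ 2 ∨ μ + ∑ p ∈ X, dTo G p {a, b} + BF ≤ s + 1) := by
    have key : ∀ n, ∀ X, X0 ⊆ X → X ⊆ P → Disjoint X F → X.card = n →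
        s ≤ μ + ∑ p ∈ X, dTo G p {a, b} + BF →
        ∃ X ⊆ P, Disjoint X F ∧
      1 ≤ μ + ∑ p ∈ X, dTo G p {a, b} ∧ s ≤ μ + ∑ p ∈ X, dTo G p {a, b} + BF ∧
      (μ + ∑ p ∈ X, dTo G p {a, b} ≤ 2 ∨ μ + ∑ p ∈ X, dTo G p {a, b} + BF ≤ s + 1) := by
      intro n
      induction n with
      | zero =>
        intro X h1 h2 h3 h4 h5
        rw [Finset.card_eq_zero] at h4
        subst h4
        have : X0 = ∅ := Finset.subset_empty.1 h1
        subst this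
        exact ⟨∅, h2, h3, hX01, h5, Or.inl hX02⟩
      | succ n ih =>
        intro X h1 h2 h3 h4 h5
        by_cases hX : X ⊆ X0
        · have : X = X0 := Finset.Subset.antisymm hX h1
          subst this
          exact ⟨X, h2, h3, hX01, h5, Or.inl hX02⟩
        · obtain ⟨x, hx, hx0⟩ := Finset.not_subset.1 hX
          have e := Finset.add_sum_erase X (fun p => dTo G p {a, b}) hx
          by_cases hh : s ≤ μ + ∑ p ∈ X.erase x, dTo G p {a, b} + BF
          · exact ih (X.erase x) (fun y hy => Finset.mem_erase.2 ⟨by rintro rfl; exact hx0 hy, h1 hy⟩)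
              ((Finset.erase_subset _ _).trans h2)
              (Finset.disjoint_of_subset_left (Finset.erase_subset _ _) h3)
              (by rw [Finset.card_erase_of_mem hx]; omega) hh
          · refine ⟨X, h2, h3, ?_, h5, Or.inr ?_⟩
            · have := Finset.sum_le_sum_of_subset (f := fun p => dTo G p {a, b}) h1
              omega
            · have := hβ2 x
              omega
    refine key _ (P \ F) ?_ Finset.sdiff_subset Finset.sdiff_disjoint rfl ?_
    · intro x hx; exact Finset.mem_sdiff.2 ⟨hX0P hx, Finset.disjoint_left.1 hd0 hx⟩
    · have := Finset.sum_sdiff (f := fun p => dTo G p {a, b}) hFP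
      omega
  have nabc : ∀ v ∈ V', v ≠ a ∧ v ≠ b ∧ v ≠ c := fun v hv => (hmV v).1 hv
  set Y := (P \ F) \ X with hY
  have hYP : Y ⊆ P := Finset.sdiff_subset.trans Finset.sdiff_subset
  have dXab : Disjoint X {a, b} := by
    rw [Finset.disjoint_left]; intro v hv; have := nabc v (hPV (hXP hv)); simp; tauto
  have dYc : Disjoint Y (insert c U) := by
    rw [Finset.disjoint_left]; intro v hv
    have := nabc v (hPV (hYP hv)); have h2 := Finset.disjoint_left.1 dPU (hYP hv)
    simp; tauto
  have dFP := Finset.disjoint_left.1 dPU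
  have heB : (eIn G (X ∪ {a, b})).card = μ + ∑ p ∈ X, dTo G p {a, b} := by
    rw [card_eIn_union G dXab, eIn_card_zero G (A := X)
      (fun x hx y hy => hP0 x (hXP hx) y (hPV (hXP hy)))]
    omega
  have hdc : ∀ p ∈ P, dTo G p (insert c U) = dTo G p {c} := by
    intro p hp
    rw [Finset.insert_eq, dTo_union, hP0' p hp U hUV, add_zero]
    rw [Finset.disjoint_singleton_left]; intro h; exact (nabc c (hUV h)).2.2 rfl
  have heS : (eIn G (Y ∪ insert c U)).card = z + ∑ p ∈ Y, dTo G p {c} := by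
    rw [card_eIn_union G dYc, eIn_card_zero G (A := Y)
      (fun x hx y hy => hP0 x (hYP hx) y (hPV (hYP hy))), hzU,
      Finset.sum_congr rfl (fun p hp => hdc p (hYP hp))]
    omega
  have hone : ∀ v ∈ M, dTo G v {c} = 1 := by
    intro v hv
    have h1 := (Finset.mem_filter.1 hv).2
    unfold dTo
    rw [Finset.card_eq_one]
    exact ⟨c, by ext u; simp only [Finset.mem_filter, Finset.mem_singleton]; constructor
                 · exact fun h => h.1
                 · rintro rfl; exact ⟨rfl, h1.symm⟩⟩
  have hYM : ∑ p ∈ Y, dTo G p {c} + F.card ≤ M.card := by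
    have h1 : ∑ p ∈ Y, dTo G p {c} = (Y.filter (fun v => G.Adj c v)).card := by
      rw [Finset.card_filter]
      apply Finset.sum_congr rfl
      intro p hp
      split_ifs with h
      · exact hone p (Finset.mem_filter.2 ⟨hYP hp, h⟩)
      · rw [dTo_eq_zero]; intro u hu; rw [Finset.mem_singleton.1 hu]; exact fun h' => h h'.symm
    rw [h1, ← Finset.card_union_of_disjoint]
    · apply Finset.card_le_card
      intro v hv
      rcases Finset.mem_union.1 hv with h | h
      · have := Finset.mem_filter.1 h
        exact Finset.mem_filter.2 ⟨hYP this.1, this.2⟩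
      · exact hFM h
    · rw [Finset.disjoint_left]
      intro v hv hF
      have := (Finset.mem_filter.1 hv).1
      rw [hY, Finset.mem_sdiff, Finset.mem_sdiff] at this
      exact this.1.2 hF
  have hFB : ∀ f ∈ F, dTo G f (X ∪ {a, b}) = dTo G f {a, b} := by
    intro f hf
    rw [dTo_union G f dXab, hP0' f (hFP hf) X (hXP.trans hPV), zero_add]
  have dXF := Finset.disjoint_left.1 hXF
  refine glue G (z := z) hm (Y ∪ insert c U) F (X ∪ {a, b}) ?_ ?_ ?_ ?_ ?_ ?_ ?_ ?_ ?_ ?_ ?_ ?_ ?_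
  · rw [Finset.disjoint_left]
    intro v hv hF
    have h1 := nabc v (hPV (hFP hF))
    have h2 := dFP (hFP hF)
    simp only [Finset.mem_union, Finset.mem_insert, hY, Finset.mem_sdiff] at hv
    tauto
  · rw [Finset.disjoint_left]
    intro v hv hB
    rcases Finset.mem_union.1 hB with hB | hB
    · have h1 := nabc v (hPV (hXP hB))
      have h2 := dFP (hXP hB)
      simp only [Finset.mem_union, Finset.mem_insert, hY, Finset.mem_sdiff] at hv
      tauto
    · simp only [Finset.mem_insert, Finset.mem_singleton] at hB
      rcases Finset.mem_union.1 hv with h | h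
      · have h1 := nabc v (hPV (hYP h)); tauto
      · rcases Finset.mem_insert.1 h with rfl | h
        · rcases hB with rfl | rfl
          · exact hac rfl
          · exact hbc rfl
        · have h1 := nabc v (hUV h); tauto
  · rw [Finset.disjoint_left]
    intro v hv hB
    have h1 := nabc v (hPV (hFP hv))
    simp only [Finset.mem_union, Finset.mem_insert, Finset.mem_singleton] at hB
    have h2 := fun h => dXF h hv
    tauto
  · intro v
    simp only [Finset.mem_union, Finset.mem_insert, Finset.mem_singleton, hY, Finset.mem_sdiff]
    have h1 := hmV v
    rw [hPU, Finset.mem_union] at h1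
    tauto
  · exact fun x hx y hy => hP0 x (hFP hx) y (hPV (hFP hy))
  · intro f hf
    rw [dTo_union G f dYc, hP0' f (hFP hf) Y (hYP.trans hPV), hdc f (hFP hf), hone f (hFM hf)]
  · intro f hf; rw [hFB f hf]; exact hβ2 f
  · omega
  · rw [heS]; omega
  · rw [heS]; omega
  · rw [heB]; omega
  · rw [heB, Finset.sum_congr rfl hFB]; omega
  · rw [heB, Finset.sum_congr rfl hFB]; omega

theorem regime3 {s : ℕ} (hs : 1000 ≤ s) (hm : G.edgeFinset.card = 3 * s + 1) (a b c : V)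
    (hab : a ≠ b) (hac : a ≠ c) (hbc : b ≠ c) (V' : Finset V)
    (hV' : V' = Finset.univ \ {a, b, c})
    (ha : 8 * dTo G a V' ≤ 9 * s) (hb : 8 * dTo G b V' ≤ 9 * s) (hc : 8 * dTo G c V' ≤ 9 * s)
    (hr : 6 * (eIn G V').card ≤ s) :
    ∃ w : V → ℕ, (∀ v, w v ≤ s) ∧ WellGuarded G s w := by
  have e1 := card_eIn_union G (A := {a, b, c}) (B := V') (by rw [hV']; exact Finset.disjoint_sdiff)
  have e2 : ({a, b, c} : Finset V) ∪ V' = Finset.univ := by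
    rw [hV']; exact Finset.union_sdiff_of_subset (Finset.subset_univ _)
  have e3 : (eIn G {a, b, c}).card = (eIn G {a, b}).card + (eIn G {b, c}).card +
      (eIn G {c, a}).card := by
    rw [card_eIn_insert G (a := a) (B := {b, c}) (by simp [hab, hac]),
      card_eIn_insert G (a := a) (B := {b}) (by simp [hab]),
      card_eIn_insert G (a := c) (B := {a}) (by simp [hac.symm]), eIn_singleton, eIn_singleton]
    have : dTo G a {b, c} = dTo G a {b} + dTo G a {c} := by
      rw [Finset.insert_eq, dTo_union G a (by simpa using hbc)]
    have h2 : dTo G c {a} = dTo G a {c} := by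
      unfold dTo
      rw [Finset.filter_singleton, Finset.filter_singleton]
      simp only [G.adj_comm c a]
      split_ifs <;> simp
    omega
  rw [e2, eIn_univ, hm, Finset.sum_insert (by simp [hab, hac]), Finset.sum_pair hbc] at e1
  have hp : ∀ x y : V, (eIn G {x, y}).card ≤ 1 := by
    intro x y
    by_cases hxy : x = y
    · subst hxy; simp [eIn_singleton]
    · rw [card_eIn_insert G (by simpa using hxy), eIn_singleton]
      have := dTo_le_card G x {y}
      simpa using this
  have p1 := hp a b
  have p2 := hp b c
  have p3 := hp c a
  by_cases h1 : s + 1 ≤ dTo G c V' + (eIn G V').card + (eIn G {a, b}).card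
  · exact regime3_core G hm a b c hab hac hbc V' hV' h1 (by omega) (by omega) (by omega) (by omega)
  by_cases h2 : s + 1 ≤ dTo G a V' + (eIn G V').card + (eIn G {b, c}).card
  · exact regime3_core G hm b c a hbc hab.symm hac.symm V'
      (by rw [hV']; congr 1; ext v; simp; tauto) h2 (by omega) (by omega) (by omega) (by omega)
  · exact regime3_core G hm c a b hac.symm hbc.symm hab V'
      (by rw [hV']; congr 1; ext v; simp; tauto) (by omega) (by omega) (by omega) (by omega) (by omega)

end RegimeThree

/-! ### second moment: expectations over independent levels -/
section Prob
variable {V : Type*} [Fintype V] [DecidableEq V]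

/-- expectation over independent levels with distributions `P v` -/
def Ex (P : V → Fin 13 → ℚ) (F : (V → Fin 13) → ℚ) : ℚ :=
  ∑ f : V → Fin 13, (∏ v, P v (f v)) * F f

variable (P : V → Fin 13 → ℚ)

theorem Ex_sum {ι : Type*} (S : Finset ι) (F : ι → (V → Fin 13) → ℚ) :
    Ex P (fun f => ∑ i ∈ S, F i f) = ∑ i ∈ S, Ex P (F i) := by
  unfold Ex
  rw [Finset.sum_comm]
  apply Finset.sum_congr rfl
  intro f _
  rw [Finset.mul_sum]

theorem Ex_mul (c : ℚ) (F : (V → Fin 13) → ℚ) : Ex P (fun f => c * F f) = c * Ex P F := by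
  unfold Ex
  rw [Finset.mul_sum]
  apply Finset.sum_congr rfl
  intro f _
  ring

theorem Ex_add (F F' : (V → Fin 13) → ℚ) :
    Ex P (fun f => F f + F' f) = Ex P F + Ex P F' := by
  unfold Ex
  rw [← Finset.sum_add_distrib]
  apply Finset.sum_congr rfl
  intro f _
  ring

theorem Ex_const (hP : ∀ v, ∑ i, P v i = 1) (c : ℚ) : Ex P (fun _ => c) = c := by
  unfold Ex
  rw [← Finset.sum_mul]
  have := Finset.prod_univ_sum (fun _ : V => (Finset.univ : Finset (Fin 13))) (fun v i => P v i)
  rw [Fintype.piFinset_univ] at this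
  rw [← this, Finset.prod_congr rfl (fun v _ => hP v), Finset.prod_const_one, one_mul]

theorem Ex_mono (h0 : ∀ v i, 0 ≤ P v i) {F F' : (V → Fin 13) → ℚ} (h : ∀ f, F f ≤ F' f) :
    Ex P F ≤ Ex P F' := by
  unfold Ex
  apply Finset.sum_le_sum
  intro f _
  exact mul_le_mul_of_nonneg_left (h f) (Finset.prod_nonneg (fun v _ => h0 v _))

theorem prod_update (f : V → Fin 13) (v : V) (i : Fin 13) :
    (∏ u, P u (f u)) * P v i = (∏ u, P u (Function.update f v i u)) * P v (f v) := by
  rw [← Finset.mul_prod_erase Finset.univ (fun u => P u (f u)) (Finset.mem_univ v),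
    ← Finset.mul_prod_erase Finset.univ (fun u => P u (Function.update f v i u)) (Finset.mem_univ v)]
  have : ∏ u ∈ Finset.univ.erase v, P u (Function.update f v i u) =
      ∏ u ∈ Finset.univ.erase v, P u (f u) := by
    apply Finset.prod_congr rfl
    intro u hu
    rw [Function.update_of_ne (Finset.ne_of_mem_erase hu)]
  rw [this]
  simp only [Function.update_self]
  ring

theorem Ex_resample (hP : ∀ v, ∑ i, P v i = 1) (v : V) (F : (V → Fin 13) → ℚ) :
    Ex P F = Ex P (fun f => ∑ i, P v i * F (Function.update f v i)) := by
  have h1 : Ex P (fun f => ∑ i, P v i * F (Function.update f v i)) =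
      ∑ x : (V → Fin 13) × Fin 13, (∏ u, P u (x.1 u)) * P v x.2 * F (Function.update x.1 v x.2) := by
    unfold Ex
    rw [Fintype.sum_prod_type]
    apply Finset.sum_congr rfl
    intro f _
    rw [Finset.mul_sum]
    apply Finset.sum_congr rfl
    intro i _
    ring
  have h2 : Ex P F = ∑ x : (V → Fin 13) × Fin 13, (∏ u, P u (x.1 u)) * P v x.2 * F x.1 := by
    unfold Ex
    rw [Fintype.sum_prod_type]
    apply Finset.sum_congr rfl
    intro f _
    have : ∑ i, (∏ u, P u (f u)) * P v i * F f = (∏ u, P u (f u)) * F f * ∑ i, P v i := by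
      rw [Finset.mul_sum]
      apply Finset.sum_congr rfl
      intro i _
      ring
    rw [this, hP, mul_one]
  rw [h1, h2]
  have inv : Function.Involutive
      (fun x : (V → Fin 13) × Fin 13 => (Function.update x.1 v x.2, x.1 v)) := by
    rintro ⟨f, i⟩
    simp
  rw [← Equiv.sum_comp inv.toPerm]
  apply Finset.sum_congr rfl
  rintro ⟨f, i⟩ _
  simp only [Function.Involutive.coe_toPerm]
  rw [← prod_update]

/-- indicator of an edge having small level sum -/
def Yi (J : ℕ) (i j : Fin 13) : ℚ := if i.val + j.val ≤ J then 1 else 0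

/-- conditional probability -/
def gq (J : ℕ) (y : V) (i : Fin 13) : ℚ := ∑ j, P y j * Yi J i j

theorem Yi_comm (J : ℕ) (i j : Fin 13) : Yi J i j = Yi J j i := by
  unfold Yi; rw [add_comm]

theorem Yi_nonneg (J : ℕ) (i j : Fin 13) : 0 ≤ Yi J i j := by
  unfold Yi; split_ifs <;> norm_num

theorem Yi_le (J : ℕ) (i j : Fin 13) : Yi J i j ≤ 1 := by
  unfold Yi; split_ifs <;> norm_num

theorem Ex_two (hP : ∀ v, ∑ i, P v i = 1) (J : ℕ) {x y : V} (hxy : x ≠ y) :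
    Ex P (fun f => Yi J (f x) (f y)) = ∑ i, P x i * gq P J y i := by
  rw [Ex_resample P hP y, Ex_resample P hP x]
  simp only [Function.update_self, Function.update_of_ne hxy]
  rw [Ex_const P hP]
  rfl

theorem Ex_three (hP : ∀ v, ∑ i, P v i = 1) (J : ℕ) {v y t : V} (hvy : v ≠ y) (hvt : v ≠ t)
    (hyt : y ≠ t) :
    Ex P (fun f => Yi J (f v) (f y) * Yi J (f v) (f t)) =
      ∑ i, P v i * (gq P J y i * gq P J t i) := by
  rw [Ex_resample P hP y]
  simp only [Function.update_self, Function.update_of_ne hvy, Function.update_of_ne hyt.symm]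
  have h1 : ∀ f : V → Fin 13, ∑ i, P y i * (Yi J (f v) i * Yi J (f v) (f t)) =
      gq P J y (f v) * Yi J (f v) (f t) := by
    intro f
    unfold gq
    rw [Finset.sum_mul]
    apply Finset.sum_congr rfl
    intro i _
    ring
  simp only [h1]
  rw [Ex_resample P hP t]
  simp only [Function.update_self, Function.update_of_ne hvt]
  have h2 : ∀ f : V → Fin 13, ∑ i, P t i * (gq P J y (f v) * Yi J (f v) i) =
      gq P J y (f v) * gq P J t (f v) := by
    intro f
    conv_rhs => rw [gq.eq_def (y := t)]
    rw [Finset.mul_sum]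
    apply Finset.sum_congr rfl
    intro i _
    ring
  simp only [h2]
  rw [Ex_resample P hP v]
  simp only [Function.update_self]
  rw [Ex_const P hP]

theorem Ex_four (hP : ∀ v, ∑ i, P v i = 1) (J : ℕ) {x y z t : V} (hxy : x ≠ y)
    (hxz : x ≠ z) (hxt : x ≠ t) (hyz : y ≠ z) (hyt : y ≠ t) :
    Ex P (fun f => Yi J (f x) (f y) * Yi J (f z) (f t)) =
      Ex P (fun f => Yi J (f x) (f y)) * Ex P (fun f => Yi J (f z) (f t)) := by
  rw [Ex_two P hP J hxy, Ex_resample P hP y]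
  simp only [Function.update_self, Function.update_of_ne hxy, Function.update_of_ne hyz.symm,
    Function.update_of_ne hyt.symm]
  rw [Ex_resample P hP x]
  simp only [Function.update_self, Function.update_of_ne hxz.symm,
    Function.update_of_ne hxt.symm]
  rw [← Ex_mul]
  congr 1
  ext f
  rw [Finset.sum_mul]
  apply Finset.sum_congr rfl
  intro i _
  unfold gq
  rw [mul_assoc, Finset.sum_mul]
  congr 1
  apply Finset.sum_congr rfl
  intro j _
  ring

/-- averaging: small total normalised variance gives a good outcome -/
theorem exists_good (hP : ∀ v, ∑ i, P v i = 1) (h0 : ∀ v i, 0 ≤ P v i)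
    (N : ℕ → (V → Fin 13) → ℚ) (μ T : ℕ → ℚ) (n : ℕ) (hT : ∀ J < n, 0 < T J)
    (h : ∑ J ∈ Finset.range n, Ex P (fun f => (N J f - μ J) ^ 2) / T J ^ 2 < 1) :
    ∃ f : V → Fin 13, ∀ J < n, |N J f - μ J| < T J := by
  by_contra! hcon
  have h1 : Ex P (fun _ => 1) ≤
      Ex P (fun f => ∑ J ∈ Finset.range n, (1 / T J ^ 2) * (N J f - μ J) ^ 2) := by
    apply Ex_mono P h0
    intro f
    obtain ⟨J, hJ, hJT⟩ := hcon f
    have h2 : (1 / T J ^ 2) * (N J f - μ J) ^ 2 ≤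
        ∑ J ∈ Finset.range n, (1 / T J ^ 2) * (N J f - μ J) ^ 2 :=
      Finset.single_le_sum (f := fun J => (1 / T J ^ 2) * (N J f - μ J) ^ 2)
        (fun i _ => by positivity) (Finset.mem_range.2 hJ)
    refine le_trans ?_ h2
    have h3 : T J ^ 2 ≤ (N J f - μ J) ^ 2 := by
      rw [← sq_abs (N J f - μ J)]
      exact pow_le_pow_left₀ (hT J hJ).le hJT 2
    have h4 : 0 < T J ^ 2 := pow_pos (hT J hJ) 2
    rw [one_div, inv_mul_eq_div, le_div_iff₀ h4, one_mul]
    exact h3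
  rw [Ex_const P hP, Ex_sum] at h1
  have h5 : ∑ J ∈ Finset.range n, Ex P (fun f => (1 / T J ^ 2) * (N J f - μ J) ^ 2) =
      ∑ J ∈ Finset.range n, Ex P (fun f => (N J f - μ J) ^ 2) / T J ^ 2 := by
    apply Finset.sum_congr rfl
    intro J _
    rw [Ex_mul]; ring
  rw [h5] at h1
  exact absurd h (not_lt.2 h1)

/-- variance of a sum -/
theorem Ex_var (hP : ∀ v, ∑ i, P v i = 1) {ι : Type*} (S : Finset ι)
    (Y : ι → (V → Fin 13) → ℚ) :
    Ex P (fun f => (∑ e ∈ S, Y e f - ∑ e ∈ S, Ex P (Y e)) ^ 2) =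
      ∑ e ∈ S, ∑ e' ∈ S, (Ex P (fun f => Y e f * Y e' f) - Ex P (Y e) * Ex P (Y e')) := by
  set μ := ∑ e ∈ S, Ex P (Y e) with hμ
  have h1 : ∀ f, (∑ e ∈ S, Y e f - μ) ^ 2 =
      (∑ e ∈ S, ∑ e' ∈ S, Y e f * Y e' f) + ((-2 * μ) * (∑ e ∈ S, Y e f) + μ ^ 2) := by
    intro f
    rw [← Finset.sum_mul_sum]
    ring
  simp only [h1]
  rw [Ex_add, Ex_add, Ex_mul, Ex_const P hP, Ex_sum, Ex_sum, ← hμ]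
  simp only [Ex_sum, Finset.sum_sub_distrib]
  rw [← Finset.sum_mul_sum, ← hμ]
  ring

end Prob

/-! ### second moment: variance of the edge counts -/
section Var
variable {V : Type*} [Fintype V] [DecidableEq V] (G : SimpleGraph V) [DecidableRel G.Adj]

/-- level distribution -/
def lvP (H H0 : Finset V) (p : Fin 13 → ℚ) (v : V) (i : Fin 13) : ℚ :=
  if v ∈ H then (if i = (if v ∈ H0 then 0 else 12) then 1 else 0) else p i

def G1 (p : Fin 13 → ℚ) (J : ℕ) (i : Fin 13) : ℚ := ∑ j, p j * Yi J i j
def F2 (p : Fin 13 → ℚ) (J : ℕ) : ℚ := ∑ i, p i * G1 p J i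
def C2 (p : Fin 13 → ℚ) (J : ℕ) : ℚ := ∑ i, p i * (G1 p J i * G1 p J i) - F2 p J * F2 p J

theorem C2_nonneg {p : Fin 13 → ℚ} (p0 : ∀ i, 0 ≤ p i) (p1 : ∑ i, p i = 1) (J : ℕ) :
    0 ≤ C2 p J := by
  have h : C2 p J = ∑ i, p i * (G1 p J i - F2 p J) ^ 2 := by
    have h1 : ∀ i, p i * (G1 p J i - F2 p J) ^ 2 =
        p i * (G1 p J i * G1 p J i) + ((-2 * F2 p J) * (p i * G1 p J i) + F2 p J ^ 2 * p i) := by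
      intro i; ring
    simp only [h1]
    rw [Finset.sum_add_distrib, Finset.sum_add_distrib, ← Finset.mul_sum, ← Finset.mul_sum, p1]
    unfold C2
    rw [show ∑ i, p i * G1 p J i = F2 p J from rfl]
    ring
  rw [h]
  exact Finset.sum_nonneg (fun i _ => mul_nonneg (p0 i) (sq_nonneg _))

theorem lvP_sum (H H0 : Finset V) {p : Fin 13 → ℚ} (p1 : ∑ i, p i = 1) (v : V) :
    ∑ i, lvP H H0 p v i = 1 := by
  unfold lvP
  split_ifs
  · simp
  · simp
  · exact p1

theorem lvP_nonneg (H H0 : Finset V) {p : Fin 13 → ℚ} (p0 : ∀ i, 0 ≤ p i) (v : V) (i : Fin 13) :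
    0 ≤ lvP H H0 p v i := by
  unfold lvP
  split_ifs <;> first | exact p0 i | norm_num

theorem sum_lvP_H (H H0 : Finset V) (p : Fin 13 → ℚ) {v : V} (hv : v ∈ H) (φ : Fin 13 → ℚ) :
    ∑ i, lvP H H0 p v i * φ i = φ (if v ∈ H0 then 0 else 12) := by
  unfold lvP
  simp [hv]

theorem sum_lvP_R (H H0 : Finset V) (p : Fin 13 → ℚ) {v : V} (hv : v ∉ H) (φ : Fin 13 → ℚ) :
    ∑ i, lvP H H0 p v i * φ i = ∑ i, p i * φ i := by
  unfold lvP
  simp [hv]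

theorem gq_R (H H0 : Finset V) (p : Fin 13 → ℚ) {v : V} (hv : v ∉ H) (J : ℕ) (i : Fin 13) :
    gq (lvP H H0 p) J v i = G1 p J i := by
  unfold gq G1
  rw [sum_lvP_R H H0 p hv]

/-- edge indicator -/
def YE (J : ℕ) (e : Sym2 V) (f : V → Fin 13) : ℚ :=
  if edgeWt (fun v => (f v).val) e ≤ J then 1 else 0

theorem YE_mk (J : ℕ) (x y : V) : YE J s(x, y) = fun f => Yi J (f x) (f y) := rfl

/-- is the edge inside R -/
def rr (H : Finset V) (e : Sym2 V) : ℚ := if e ∈ eIn G Hᶜ then 1 else 0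

theorem rr_nonneg (H : Finset V) (e : Sym2 V) : 0 ≤ rr G H e := by
  unfold rr; split_ifs <;> norm_num
theorem rr_le (H : Finset V) (e : Sym2 V) : rr G H e ≤ 1 := by
  unfold rr; split_ifs <;> norm_num

theorem YE_nonneg (J : ℕ) (e : Sym2 V) (f : V → Fin 13) : 0 ≤ YE J e f := by
  unfold YE; split_ifs <;> norm_num
theorem YE_le (J : ℕ) (e : Sym2 V) (f : V → Fin 13) : YE J e f ≤ 1 := by
  unfold YE; split_ifs <;> norm_num

/-- covariance bound term at a vertex -/
def cvt (H : Finset V) (c : ℚ) (v : V) (e e' : Sym2 V) : ℚ :=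
  if v ∈ e ∧ v ∈ e' then c * (rr G H e * rr G H e') + ((1 - rr G H e) + (1 - rr G H e')) else 0

theorem cvt_nonneg (H : Finset V) {c : ℚ} (hc : 0 ≤ c) (v : V) (e e' : Sym2 V) :
    0 ≤ cvt G H c v e e' := by
  unfold cvt
  have h1 := rr_nonneg G H e
  have h2 := rr_nonneg G H e'
  have h3 := rr_le G H e
  have h4 := rr_le G H e'
  split_ifs
  · have := mul_nonneg hc (mul_nonneg h1 h2)
    linarith
  · exact le_rfl

theorem Ex_YE_nonneg (H H0 : Finset V) {p : Fin 13 → ℚ} (p0 : ∀ i, 0 ≤ p i) (p1 : ∑ i, p i = 1)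
    (J : ℕ) (e : Sym2 V) : 0 ≤ Ex (lvP H H0 p) (YE J e) := by
  have := Ex_mono (lvP H H0 p) (lvP_nonneg H H0 p0) (YE_nonneg J e)
  rwa [Ex_const _ (lvP_sum H H0 p1)] at this

theorem Ex_YE_le (H H0 : Finset V) {p : Fin 13 → ℚ} (p0 : ∀ i, 0 ≤ p i) (p1 : ∑ i, p i = 1)
    (J : ℕ) (e : Sym2 V) : Ex (lvP H H0 p) (YE J e) ≤ 1 := by
  have := Ex_mono (lvP H H0 p) (lvP_nonneg H H0 p0) (YE_le J e)
  rwa [Ex_const _ (lvP_sum H H0 p1)] at this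

theorem cov_le_one (H H0 : Finset V) {p : Fin 13 → ℚ} (p0 : ∀ i, 0 ≤ p i) (p1 : ∑ i, p i = 1)
    (J : ℕ) (e e' : Sym2 V) :
    Ex (lvP H H0 p) (fun f => YE J e f * YE J e' f) -
      Ex (lvP H H0 p) (YE J e) * Ex (lvP H H0 p) (YE J e') ≤ 1 := by
  have h1 := Ex_mono (lvP H H0 p) (lvP_nonneg H H0 p0) (F := fun f => YE J e f * YE J e' f)
    (F' := fun _ => 1) (fun f => mul_le_one₀ (YE_le J e f) (YE_nonneg J e' f) (YE_le J e' f))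
  rw [Ex_const _ (lvP_sum H H0 p1)] at h1
  have := mul_nonneg (Ex_YE_nonneg H H0 p0 p1 J e) (Ex_YE_nonneg H H0 p0 p1 J e')
  linarith

theorem cov_star (H H0 : Finset V) {p : Fin 13 → ℚ} (p0 : ∀ i, 0 ≤ p i) (p1 : ∑ i, p i = 1)
    (J : ℕ) {v y t : V} (hy : G.Adj v y) (ht : G.Adj v t) (hyt : y ≠ t) :
    Ex (lvP H H0 p) (fun f => YE J s(v, y) f * YE J s(v, t) f) -
      Ex (lvP H H0 p) (YE J s(v, y)) * Ex (lvP H H0 p) (YE J s(v, t)) ≤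
      ∑ u ∈ Hᶜ, cvt G H (C2 p J) u s(v, y) s(v, t) := by
  have hC := C2_nonneg p0 p1 J
  have hnn : 0 ≤ ∑ u ∈ Hᶜ, cvt G H (C2 p J) u s(v, y) s(v, t) :=
    Finset.sum_nonneg (fun u _ => cvt_nonneg G H hC u _ _)
  have hs := lvP_sum H H0 p1
  have e1 : Ex (lvP H H0 p) (fun f => YE J s(v, y) f * YE J s(v, t) f) = _ :=
    Ex_three (lvP H H0 p) hs J hy.ne ht.ne hyt
  by_cases hv : v ∈ H
  · rw [e1, YE_mk, YE_mk, Ex_two _ hs J hy.ne, Ex_two _ hs J ht.ne, sum_lvP_H _ _ _ hv,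
      sum_lvP_H _ _ _ hv, sum_lvP_H _ _ _ hv]
    simpa using hnn
  have hv' : v ∈ Hᶜ := Finset.mem_compl.2 hv
  refine le_trans ?_ (Finset.single_le_sum (f := fun u => cvt G H (C2 p J) u s(v, y) s(v, t))
    (fun u _ => cvt_nonneg G H hC u _ _) hv')
  have hcv : cvt G H (C2 p J) v s(v, y) s(v, t) = C2 p J * (rr G H s(v, y) * rr G H s(v, t)) +
      ((1 - rr G H s(v, y)) + (1 - rr G H s(v, t))) := by
    unfold cvt; rw [if_pos]; simp
  simp only [hcv]
  have r1 : rr G H s(v, y) = if y ∈ H then 0 else 1 := by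
    unfold rr; simp [mk_mem_eIn, hy, hv]
  have r2 : rr G H s(v, t) = if t ∈ H then 0 else 1 := by
    unfold rr; simp [mk_mem_eIn, ht, hv]
  have hone := cov_le_one H H0 p0 p1 J s(v, y) s(v, t)
  by_cases hyH : y ∈ H
  · rw [r1, r2, if_pos hyH]
    split_ifs <;> linarith
  by_cases htH : t ∈ H
  · rw [r1, r2, if_pos htH]
    split_ifs; linarith
  rw [r1, r2, if_neg hyH, if_neg htH, e1, YE_mk, YE_mk, Ex_two _ hs J hy.ne, Ex_two _ hs J ht.ne,
    sum_lvP_R _ _ _ hv, sum_lvP_R _ _ _ hv, sum_lvP_R _ _ _ hv]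
  simp only [gq_R H H0 p hyH, gq_R H H0 p htH]
  apply le_of_eq
  unfold C2 F2
  ring

theorem cov_bound (H H0 : Finset V) {p : Fin 13 → ℚ} (p0 : ∀ i, 0 ≤ p i) (p1 : ∑ i, p i = 1)
    (J : ℕ) {e e' : Sym2 V} (he : e ∈ G.edgeFinset) (he' : e' ∈ G.edgeFinset) :
    Ex (lvP H H0 p) (fun f => YE J e f * YE J e' f) -
      Ex (lvP H H0 p) (YE J e) * Ex (lvP H H0 p) (YE J e') ≤
      (if e = e' then 1 else 0) + ∑ u ∈ Hᶜ, cvt G H (C2 p J) u e e' := by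
  have hC := C2_nonneg p0 p1 J
  have hnn : 0 ≤ ∑ u ∈ Hᶜ, cvt G H (C2 p J) u e e' :=
    Finset.sum_nonneg (fun u _ => cvt_nonneg G H hC u _ _)
  by_cases hee : e = e'
  · rw [if_pos hee]
    have := cov_le_one H H0 p0 p1 J e e'
    linarith
  rw [if_neg hee, zero_add]
  have hs := lvP_sum H H0 p1
  by_cases hd : ∃ v, v ∈ e ∧ v ∈ e'
  · obtain ⟨v, h1, h2⟩ := hd
    obtain ⟨y, rfl⟩ := Sym2.mem_iff_exists.1 h1
    obtain ⟨t, rfl⟩ := Sym2.mem_iff_exists.1 h2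
    rw [SimpleGraph.mem_edgeFinset, SimpleGraph.mem_edgeSet] at he he'
    exact cov_star G H H0 p0 p1 J he he' (by rintro rfl; exact hee rfl)
  · refine le_trans (le_of_eq ?_) hnn
    induction e with | _ x y =>
    induction e' with | _ z t =>
    rw [SimpleGraph.mem_edgeFinset, SimpleGraph.mem_edgeSet] at he he'
    push Not at hd
    have h1 := hd x (by simp)
    have h2 := hd y (by simp)
    rw [Sym2.mem_iff, not_or] at h1 h2
    rw [sub_eq_zero]
    exact Ex_four (lvP H H0 p) hs J he.ne h1.1 h1.2 h2.1 h2.2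

theorem card_inc {A : Finset V} {v : V} (hv : v ∈ A) :
    ((eIn G A).filter (fun e => v ∈ e)).card = dTo G v A := by
  unfold dTo
  rw [← Finset.card_image_of_injOn (f := fun u => s(v, u)) (s := A.filter (fun u => G.Adj v u))]
  · congr 1
    ext e
    simp only [Finset.mem_filter, Finset.mem_image]
    constructor
    · rintro ⟨h1, h2⟩
      obtain ⟨y, rfl⟩ := Sym2.mem_iff_exists.1 h2
      rw [mk_mem_eIn] at h1
      exact ⟨y, ⟨h1.2.2, h1.1⟩, rfl⟩
    · rintro ⟨y, ⟨h1, h2⟩, rfl⟩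
      rw [mk_mem_eIn]
      exact ⟨⟨h2, hv, h1⟩, by simp⟩
  · intro x _ y _ h
    exact Sym2.congr_right.1 h

theorem var_bound (H H0 : Finset V) {p : Fin 13 → ℚ} (p0 : ∀ i, 0 ≤ p i) (p1 : ∑ i, p i = 1)
    (J : ℕ) {k m : ℕ} (hk : H.card ≤ k) (hm : G.edgeFinset.card = m) :
    Ex (lvP H H0 p) (fun f => (∑ e ∈ G.edgeFinset, YE J e f -
      ∑ e ∈ G.edgeFinset, Ex (lvP H H0 p) (YE J e)) ^ 2) ≤
      C2 p J * (∑ v ∈ Hᶜ, (dTo G v Hᶜ : ℚ) ^ 2) + (4 * k + 1) * m := by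
  rw [Ex_var _ (lvP_sum H H0 p1)]
  set E := G.edgeFinset with hE
  have h1 : ∑ e ∈ E, ∑ e' ∈ E, (Ex (lvP H H0 p) (fun f => YE J e f * YE J e' f) -
      Ex (lvP H H0 p) (YE J e) * Ex (lvP H H0 p) (YE J e')) ≤
      ∑ e ∈ E, ∑ e' ∈ E, ((if e = e' then 1 else 0) + ∑ u ∈ Hᶜ, cvt G H (C2 p J) u e e') :=
    Finset.sum_le_sum (fun e he => Finset.sum_le_sum (fun e' he' =>
      cov_bound G H H0 p0 p1 J he he'))
  refine h1.trans ?_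
  simp only [Finset.sum_add_distrib]
  have h2 : ∑ e ∈ E, ∑ e' ∈ E, (if e = e' then (1 : ℚ) else 0) = m := by
    rw [Finset.sum_congr rfl (fun e he => by rw [Finset.sum_ite_eq, if_pos he])]
    simp [hm]
  rw [h2]
  have h3 : ∑ e ∈ E, ∑ e' ∈ E, ∑ u ∈ Hᶜ, cvt G H (C2 p J) u e e' =
      ∑ u ∈ Hᶜ, ∑ e ∈ E, ∑ e' ∈ E, cvt G H (C2 p J) u e e' := by
    rw [Finset.sum_congr rfl (fun e _ => Finset.sum_comm), Finset.sum_comm]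
  rw [h3]
  have h4 : ∀ u ∈ Hᶜ, ∑ e ∈ E, ∑ e' ∈ E, cvt G H (C2 p J) u e e' =
      C2 p J * (dTo G u Hᶜ : ℚ) ^ 2 + 2 * (G.degree u * dTo G u H) := by
    intro u hu
    have hdeg : (E.filter (fun e => u ∈ e)).card = G.degree u := by
      rw [← dTo_univ, ← card_inc G (Finset.mem_univ u), eIn_univ]
    have hsum : ∑ e ∈ E.filter (fun e => u ∈ e), rr G H e = dTo G u Hᶜ := by
      unfold rr
      rw [Finset.sum_ite, Finset.sum_const_zero, add_zero, Finset.sum_const, nsmul_eq_mul, mul_one,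
        ← card_inc G hu]
      congr 2
      ext e
      simp only [Finset.mem_filter]
      have : e ∈ eIn G Hᶜ → e ∈ E := fun h => eIn_subset_edge G Hᶜ h
      tauto
    have hsplit : (G.degree u : ℚ) = dTo G u H + dTo G u Hᶜ := by
      rw [← dTo_univ, ← Finset.union_compl H, dTo_union G u disjoint_compl_right]
      push_cast; rfl
    have hc1 : ∑ e ∈ E, ∑ e' ∈ E, cvt G H (C2 p J) u e e' =
        ∑ e ∈ E.filter (fun e => u ∈ e), ∑ e' ∈ E.filter (fun e => u ∈ e),
          (C2 p J * (rr G H e * rr G H e') + ((1 - rr G H e) + (1 - rr G H e'))) := by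
      rw [Finset.sum_filter]
      apply Finset.sum_congr rfl
      intro e _
      split_ifs with h
      · rw [Finset.sum_filter]
        apply Finset.sum_congr rfl
        intro e' _
        unfold cvt
        simp [h]
      · apply Finset.sum_eq_zero
        intro e' _
        unfold cvt
        simp [h]
    rw [hc1]
    simp only [Finset.sum_add_distrib, Finset.sum_sub_distrib, ← Finset.mul_sum, ← Finset.sum_mul,
      hsum, Finset.sum_const, hdeg, nsmul_eq_mul, mul_one]
    rw [hsplit]
    ring
  rw [Finset.sum_congr rfl h4, Finset.sum_add_distrib, ← Finset.mul_sum]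
  have h5 : ∑ u ∈ Hᶜ, 2 * ((G.degree u : ℚ) * dTo G u H) ≤ 4 * k * m := by
    have h6 : ∑ u ∈ Hᶜ, 2 * ((G.degree u : ℚ) * dTo G u H) ≤ ∑ u ∈ Hᶜ, 2 * k * (G.degree u : ℚ) := by
      apply Finset.sum_le_sum
      intro u _
      have : (dTo G u H : ℚ) ≤ k := by exact_mod_cast (dTo_le_card G u H).trans hk
      have h0 : (0 : ℚ) ≤ G.degree u := by positivity
      nlinarith
    refine h6.trans ?_
    rw [← Finset.mul_sum]
    have h7 : ∑ u ∈ Hᶜ, (G.degree u : ℚ) ≤ 2 * m := by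
      have := Finset.sum_le_sum_of_subset (f := fun u => G.degree u) (Finset.subset_univ Hᶜ)
      rw [G.sum_degrees_eq_twice_card_edges, hm] at this
      exact_mod_cast this
    have h0 : (0 : ℚ) ≤ 2 * k := by positivity
    nlinarith
  linarith

end Var

/-! ### second moment: main probabilistic lemma -/
section ProbMain
variable {V : Type*} [Fintype V] [DecidableEq V] (G : SimpleGraph V) [DecidableRel G.Adj]

theorem levels_wg {s : ℕ} (hs : 300 ≤ s) (hm : G.edgeFinset.card = 3 * s + 1) (f : V → Fin 13)
    (hlo : ∀ J < 24, (J + 1) * (s / 12) + 22 ≤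
      (G.edgeFinset.filter (fun e => edgeWt (fun v => (f v).val) e ≤ J)).card)
    (hhi : ∀ J < 24, (G.edgeFinset.filter (fun e => edgeWt (fun v => (f v).val) e ≤ J)).card ≤
      J * (s / 12) + s + 1) :
    ∃ w : V → ℕ, (∀ v, w v ≤ s) ∧ WellGuarded G s w := by
  obtain ⟨q, hq⟩ : ∃ q, q = s / 12 := ⟨_, rfl⟩
  rw [← hq] at hlo hhi
  obtain ⟨r, hr, hr2⟩ : ∃ r, s = 12 * q + r ∧ r ≤ 11 := ⟨s % 12, by omega, by omega⟩
  have hq0 : 0 < q := by omega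
  set w : V → ℕ := fun v => if (f v).val = 12 then s else (f v).val * q with hw
  have hw1 : ∀ v, (f v).val * q ≤ w v ∧ w v ≤ (f v).val * q + 11 ∧ w v ≤ s ∧
      ((f v).val = 0 → w v = 0) ∧ ((f v).val = 12 → w v = s) := by
    intro v
    have h13 : (f v).val ≤ 12 := by have := (f v).isLt; omega
    simp only [hw]
    split_ifs with h
    · rw [h]; refine ⟨by omega, by omega, le_rfl, by omega, fun _ => rfl⟩
    · refine ⟨le_rfl, by omega, ?_, ?_, ?_⟩
      · have : (f v).val * q ≤ 12 * q := Nat.mul_le_mul_right q h13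
        omega
      · intro h0; rw [h0]; omega
      · intro h0; exact absurd h0 h
  refine ⟨w, fun v => (hw1 v).2.2.1, ?_⟩
  intro i hi
  rw [cntL_eq]
  unfold cntL
  have hcard : (G.edgeFinset.filter (fun e => edgeWt w e ≤ i)).card ≤ 3 * s + 1 := by
    rw [← hm]; exact Finset.card_le_card (Finset.filter_subset _ _)
  rcases hi.eq_or_lt with hi | hi
  · have : G.edgeFinset.filter (fun e => edgeWt w e ≤ i) = G.edgeFinset := by
      apply Finset.filter_true_of_mem
      intro e _
      induction e with | _ x y =>
      rw [edgeWt_mk]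
      have := (hw1 x).2.2.1
      have := (hw1 y).2.2.1
      omega
    rw [this, hm]
    omega
  constructor
  · rcases lt_or_ge i 22 with h | h
    · have h0 := hlo 0 (by norm_num)
      have : G.edgeFinset.filter (fun e => edgeWt (fun v => (f v).val) e ≤ 0) ⊆
          G.edgeFinset.filter (fun e => edgeWt w e ≤ i) := by
        intro e
        induction e with | _ x y =>
        simp only [Finset.mem_filter, edgeWt_mk]
        rintro ⟨h1, h2⟩
        refine ⟨h1, ?_⟩
        rw [(hw1 x).2.2.2.1 (by omega), (hw1 y).2.2.2.1 (by omega)]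
        omega
      have := Finset.card_le_card this
      omega
    · have hJ1 := Nat.div_add_mod (i - 22) q
      have hJ2 := Nat.mod_lt (i - 22) hq0
      set J := (i - 22) / q with hJ
      have hJ24 : J < 24 := by
        rw [hJ, Nat.div_lt_iff_lt_mul hq0]; omega
      have h0 := hlo J hJ24
      have : G.edgeFinset.filter (fun e => edgeWt (fun v => (f v).val) e ≤ J) ⊆
          G.edgeFinset.filter (fun e => edgeWt w e ≤ i) := by
        intro e
        induction e with | _ x y =>
        simp only [Finset.mem_filter, edgeWt_mk]
        rintro ⟨h1, h2⟩
        refine ⟨h1, ?_⟩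
        have hx := (hw1 x).2.1
        have hy := (hw1 y).2.1
        have := Nat.mul_le_mul_right q h2
        rw [add_mul] at this
        have e1 : J * q = q * J := mul_comm _ _
        omega
      have := Finset.card_le_card this
      have e1 : (J + 1) * q = q * J + q := by ring
      omega
  · have hJ1 := Nat.div_add_mod i q
    have hJ2 := Nat.mod_lt i hq0
    set J := i / q with hJ
    have key : ∀ x y : V, w x + w y ≤ i → (f x).val + (f y).val ≤ J ∧
        (f x).val + (f y).val ≤ 23 := by
      intro x y hle
      have hx := hw1 x
      have hy := hw1 y
      constructor
      · rw [hJ, Nat.le_div_iff_mul_le hq0, add_mul]; omega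
      · have h1 : (f x).val ≤ 12 := by have := (f x).isLt; omega
        have h2 : (f y).val ≤ 12 := by have := (f y).isLt; omega
        by_contra hh
        rw [hx.2.2.2.2 (by omega), hy.2.2.2.2 (by omega)] at hle
        omega
    obtain ⟨J', hJ', hJJ, hmin⟩ : ∃ J', J' < 24 ∧ J' ≤ J ∧ ∀ n, n ≤ J → n ≤ 23 → n ≤ J' := by
      refine ⟨min J 23, by omega, by omega, fun n h1 h2 => by omega⟩
    have h0 := hhi J' hJ'
    have : G.edgeFinset.filter (fun e => edgeWt w e ≤ i) ⊆
        G.edgeFinset.filter (fun e => edgeWt (fun v => (f v).val) e ≤ J') := by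
      intro e
      induction e with | _ x y =>
      simp only [Finset.mem_filter, edgeWt_mk]
      rintro ⟨h1, h2⟩
      have := key x y h2
      exact ⟨h1, hmin _ this.1 this.2⟩
    have := Finset.card_le_card this
    have h1 : J' * q ≤ J * q := Nat.mul_le_mul_right q hJJ
    have e1 : J * q = q * J := mul_comm _ _
    omega

theorem edge_split (H H0 : Finset V) (h0 : H0 ⊆ H) (φ : Sym2 V → ℚ) :
    ∑ e ∈ G.edgeFinset, φ e = ∑ e ∈ eCr G H0 Hᶜ, φ e + ∑ e ∈ eCr G (H \ H0) Hᶜ, φ e +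
      ∑ e ∈ eIn G Hᶜ, φ e + ∑ e ∈ eIn G H, φ e := by
  rw [← Finset.sum_union, ← Finset.sum_union, ← Finset.sum_union]
  · apply Finset.sum_congr _ (fun _ _ => rfl)
    ext e
    induction e with | _ x y =>
    simp only [Finset.mem_union, mk_mem_eIn, mk_mem_eCr, SimpleGraph.mem_edgeFinset,
      SimpleGraph.mem_edgeSet, Finset.mem_compl, Finset.mem_sdiff]
    tauto
  all_goals
    rw [Finset.disjoint_left]
    intro e
    induction e with | _ x y =>
    have hx := @h0 x
    have hy := @h0 y
    simp only [Finset.mem_union, mk_mem_eIn, mk_mem_eCr, Finset.mem_compl, Finset.mem_sdiff]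
    tauto

theorem mean_bounds (H H0 : Finset V) (h0 : H0 ⊆ H) {p : Fin 13 → ℚ} (p0 : ∀ i, 0 ≤ p i)
    (p1 : ∑ i, p i = 1) (J : ℕ) :
    (eCr G H0 Hᶜ).card * G1 p J 0 + (eCr G (H \ H0) Hᶜ).card * G1 p J 12 +
      (eIn G Hᶜ).card * F2 p J ≤ ∑ e ∈ G.edgeFinset, Ex (lvP H H0 p) (YE J e) ∧
    ∑ e ∈ G.edgeFinset, Ex (lvP H H0 p) (YE J e) ≤
      (eCr G H0 Hᶜ).card * G1 p J 0 + (eCr G (H \ H0) Hᶜ).card * G1 p J 12 +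
      (eIn G Hᶜ).card * F2 p J + (eIn G H).card := by
  have hs := lvP_sum H H0 p1
  rw [edge_split G H H0 h0]
  have e1 : ∑ e ∈ eCr G H0 Hᶜ, Ex (lvP H H0 p) (YE J e) = (eCr G H0 Hᶜ).card * G1 p J 0 := by
    rw [← nsmul_eq_mul]
    apply Finset.sum_eq_card_nsmul
    intro e
    induction e with | _ x y =>
    rw [mk_mem_eCr]
    have key : ∀ x y, G.Adj x y → x ∈ H0 → y ∈ Hᶜ → Ex (lvP H H0 p) (YE J s(x, y)) = G1 p J 0 := by
      intro x y hxy hx hy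
      rw [YE_mk, Ex_two _ hs J hxy.ne, sum_lvP_H _ _ _ (h0 hx), if_pos hx,
        gq_R _ _ _ (Finset.mem_compl.1 hy)]
    rintro ⟨h, (⟨h1, h2⟩ | ⟨h1, h2⟩)⟩
    · exact key x y h h1 h2
    · rw [Sym2.eq_swap]; exact key y x h.symm h1 h2
  have e2 : ∑ e ∈ eCr G (H \ H0) Hᶜ, Ex (lvP H H0 p) (YE J e) =
      (eCr G (H \ H0) Hᶜ).card * G1 p J 12 := by
    rw [← nsmul_eq_mul]
    apply Finset.sum_eq_card_nsmul
    intro e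
    induction e with | _ x y =>
    rw [mk_mem_eCr]
    have key : ∀ x y, G.Adj x y → x ∈ H \ H0 → y ∈ Hᶜ →
        Ex (lvP H H0 p) (YE J s(x, y)) = G1 p J 12 := by
      intro x y hxy hx hy
      rw [Finset.mem_sdiff] at hx
      rw [YE_mk, Ex_two _ hs J hxy.ne, sum_lvP_H _ _ _ hx.1, if_neg hx.2,
        gq_R _ _ _ (Finset.mem_compl.1 hy)]
    rintro ⟨h, (⟨h1, h2⟩ | ⟨h1, h2⟩)⟩
    · exact key x y h h1 h2
    · rw [Sym2.eq_swap]; exact key y x h.symm h1 h2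
  have e3 : ∑ e ∈ eIn G Hᶜ, Ex (lvP H H0 p) (YE J e) = (eIn G Hᶜ).card * F2 p J := by
    rw [← nsmul_eq_mul]
    apply Finset.sum_eq_card_nsmul
    intro e
    induction e with | _ x y =>
    rw [mk_mem_eIn]
    rintro ⟨h, h1, h2⟩
    rw [YE_mk, Ex_two _ hs J h.ne, sum_lvP_R _ _ _ (Finset.mem_compl.1 h1)]
    simp only [gq_R H H0 p (Finset.mem_compl.1 h2)]
    rfl
  have e4 : 0 ≤ ∑ e ∈ eIn G H, Ex (lvP H H0 p) (YE J e) :=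
    Finset.sum_nonneg (fun e _ => Ex_YE_nonneg H H0 p0 p1 J e)
  have e5 : ∑ e ∈ eIn G H, Ex (lvP H H0 p) (YE J e) ≤ (eIn G H).card := by
    have := Finset.sum_le_card_nsmul (eIn G H) (fun e => Ex (lvP H H0 p) (YE J e)) 1
      (fun e _ => Ex_YE_le H H0 p0 p1 J e)
    simpa using this
  rw [e1, e2, e3]
  constructor <;> linarith

theorem prob_main {s k : ℕ} (hs : 300 ≤ s) (hm : G.edgeFinset.card = 3 * s + 1)
    (H H0 : Finset V) (h0 : H0 ⊆ H) (hk : H.card ≤ k) {p : Fin 13 → ℚ} (p0 : ∀ i, 0 ≤ p i)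
    (p1 : ∑ i, p i = 1) (T : ℕ → ℚ) (hT : ∀ J < 24, 0 < T J) (W : ℚ)
    (hW : ∑ v ∈ Hᶜ, (dTo G v Hᶜ : ℚ) ^ 2 ≤ W)
    (hV : ∑ J ∈ Finset.range 24,
      (C2 p J * W + (4 * k + 1) * ((3 * s + 1 : ℕ) : ℚ)) / T J ^ 2 < 1)
    (lo : ∀ J : ℕ, J < 24 → ((J : ℚ) + 1) / 36 * (3 * s + 1) + 22 + T J ≤ (eCr G H0 Hᶜ).card * G1 p J 0 +
      (eCr G (H \ H0) Hᶜ).card * G1 p J 12 + (eIn G Hᶜ).card * F2 p J)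
    (hi : ∀ J : ℕ, J < 24 → (eCr G H0 Hᶜ).card * G1 p J 0 +
      (eCr G (H \ H0) Hᶜ).card * G1 p J 12 + (eIn G Hᶜ).card * F2 p J + (eIn G H).card + T J ≤
      ((J : ℚ) + 12) / 36 * (3 * s + 1) - 22) :
    ∃ w : V → ℕ, (∀ v, w v ≤ s) ∧ WellGuarded G s w := by
  obtain ⟨f, hf⟩ := exists_good (lvP H H0 p) (lvP_sum H H0 p1) (lvP_nonneg H H0 p0)
    (fun J f => ∑ e ∈ G.edgeFinset, YE J e f)
    (fun J => ∑ e ∈ G.edgeFinset, Ex (lvP H H0 p) (YE J e)) T 24 hT (by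
      refine lt_of_le_of_lt (Finset.sum_le_sum ?_) hV
      intro J hJ
      have hTJ := hT J (Finset.mem_range.1 hJ)
      have h1 := var_bound G H H0 p0 p1 J hk hm
      have h2 := mul_le_mul_of_nonneg_left hW (C2_nonneg p0 p1 J)
      have h3 : 0 < T J ^ 2 := by positivity
      apply div_le_div_of_nonneg_right _ h3.le
      linarith)
  have hcnt : ∀ J, ∑ e ∈ G.edgeFinset, YE J e f =
      ((G.edgeFinset.filter (fun e => edgeWt (fun v => (f v).val) e ≤ J)).card : ℚ) := by
    intro J
    unfold YE
    rw [Finset.sum_boole]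
  apply levels_wg G hs hm f
  · intro J hJ
    have h1 := hf J hJ
    rw [abs_lt, hcnt] at h1
    have h2 := lo J hJ
    have h3 := (mean_bounds G H H0 h0 p0 p1 J).1
    have h4 : (((s / 12 : ℕ) : ℚ)) ≤ (s : ℚ) / 12 := Nat.cast_div_le
    have h5 : ((J : ℚ) + 1) * ((s / 12 : ℕ) : ℚ) ≤ ((J : ℚ) + 1) * ((s : ℚ) / 12) :=
      mul_le_mul_of_nonneg_left h4 (by positivity)
    have h7 : (0 : ℚ) ≤ J := by positivity
    have h6 : (((J + 1) * (s / 12) + 22 : ℕ) : ℚ) ≤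
        ((G.edgeFinset.filter (fun e => edgeWt (fun v => (f v).val) e ≤ J)).card : ℚ) := by
      push_cast
      push_cast at h5
      linarith
    exact_mod_cast h6
  · intro J hJ
    have h1 := hf J hJ
    rw [abs_lt, hcnt] at h1
    have h2 := hi J hJ
    have h3 := (mean_bounds G H H0 h0 p0 p1 J).2
    have h4 : (s : ℚ) ≤ 12 * ((s / 12 : ℕ) : ℚ) + 11 := by
      have : s ≤ 12 * (s / 12) + 11 := by omega
      exact_mod_cast this
    have h7 : (0 : ℚ) ≤ J := by positivity
    have h8 : (J : ℚ) ≤ 23 := by exact_mod_cast (by omega : J ≤ 23)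
    have h5 : (J : ℚ) * s ≤ J * (12 * ((s / 12 : ℕ) : ℚ) + 11) := mul_le_mul_of_nonneg_left h4 h7
    have h6 : ((G.edgeFinset.filter (fun e => edgeWt (fun v => (f v).val) e ≤ J)).card : ℚ) ≤
        ((J * (s / 12) + s + 1 : ℕ) : ℚ) := by
      push_cast
      push_cast at h5
      linarith
    exact_mod_cast h6

end ProbMain

/-! ### the numerical cells -/
section Cells

def gN (P : Fin 13 → ℤ) (J : ℕ) (i : Fin 13) : ℤ := ∑ j, if i.val + j.val ≤ J then P j else 0
def FN (P : Fin 13 → ℤ) (J : ℕ) : ℤ := ∑ i, P i * gN P J i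
def SN (P : Fin 13 → ℤ) (J : ℕ) : ℤ := ∑ i, P i * (gN P J i * gN P J i)

/-- slack at one corner -/
def corn (J g0 g12 F X Y : ℤ) : ℤ :=
  min (X * 10000 * g0 + Y * 10000 * g12 + (230400 - X - Y) * F - (J + 1) * 640000000000)
    ((J + 12) * 640000000000 - (X * 10000 * g0 + Y * 10000 * g12 + (230400 - X - Y) * F))

def TNa (J g0 g12 F x1 x2 l1 u0 u1 : ℤ) : ℤ :=
  min (min (corn J g0 g12 F (16 * x1) (l1 * x1)) (corn J g0 g12 F (16 * x1) (230400 * u0 + u1 * x1)))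
    (min (corn J g0 g12 F (16 * x2) (l1 * x2)) (corn J g0 g12 F (16 * x2) (230400 * u0 + u1 * x2)))
    - 16588800000

def TN (P : Fin 13 → ℤ) (x1 x2 l1 u0 u1 : ℤ) (J : ℕ) : ℤ :=
  TNa J (gN P J 0) (gN P J 12) (FN P J) x1 x2 l1 u0 u1

def VN (P : Fin 13 → ℤ) (J : ℕ) : ℤ :=
  5008 * (10000 * SN P J - FN P J * FN P J) + 572000000000000000

structure CellOK (P : Fin 13 → ℤ) (x1 x2 l1 u0 u1 : ℤ) : Prop where
  nn : ∀ i, 0 ≤ P i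
  sm : ∑ i, P i = 10000
  tp : ∀ J < 24, 0 < TN P x1 x2 l1 u0 u1 J
  vs : ∑ J ∈ Finset.range 24, (VN P J * 530841600 / (TN P x1 x2 l1 u0 u1 J) ^ 2 + 1) < 1000000

theorem trap {M a b c0 c1 c2 x1 x2 l1 u0 u1 : ℚ} (hM : 0 ≤ M)
    (h1 : x1 * M ≤ 14400 * a) (h2 : 14400 * a ≤ x2 * M) (h3 : l1 * a ≤ 16 * b)
    (h4 : 16 * b ≤ 16 * u0 * M + u1 * a)
    (k1 : 0 ≤ 230400 * c0 + c1 * (16 * x1) + c2 * (l1 * x1))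
    (k2 : 0 ≤ 230400 * c0 + c1 * (16 * x1) + c2 * (230400 * u0 + u1 * x1))
    (k3 : 0 ≤ 230400 * c0 + c1 * (16 * x2) + c2 * (l1 * x2))
    (k4 : 0 ≤ 230400 * c0 + c1 * (16 * x2) + c2 * (230400 * u0 + u1 * x2)) :
    0 ≤ c0 * M + c1 * a + c2 * b := by
  have k1 := mul_nonneg k1 hM
  have k2 := mul_nonneg k2 hM
  have k3 := mul_nonneg k3 hM
  have k4 := mul_nonneg k4 hM
  rcases le_total 0 c2 with hc | hc
  · have e1 := mul_le_mul_of_nonneg_left h3 hc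
    rcases le_total 0 (16 * c1 + c2 * l1) with hd | hd
    · have e2 := mul_le_mul_of_nonneg_left h1 hd
      linarith
    · have e2 := mul_le_mul_of_nonpos_left h2 hd
      linarith
  · have e1 := mul_le_mul_of_nonpos_left h4 hc
    rcases le_total 0 (16 * c1 + c2 * u1) with hd | hd
    · have e2 := mul_le_mul_of_nonneg_left h1 hd
      linarith
    · have e2 := mul_le_mul_of_nonpos_left h2 hd
      linarith

theorem G1_eq (P : Fin 13 → ℤ) (J : ℕ) (i : Fin 13) :
    G1 (fun i => (P i : ℚ) / 10000) J i = (gN P J i : ℚ) / 10000 := by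
  unfold G1 gN Yi
  rw [Int.cast_sum, Finset.sum_div]
  refine Finset.sum_congr rfl fun j _ => ?_
  split_ifs <;> simp

theorem F2_eq (P : Fin 13 → ℤ) (J : ℕ) :
    F2 (fun i => (P i : ℚ) / 10000) J = (FN P J : ℚ) / 100000000 := by
  unfold F2 FN
  rw [Int.cast_sum, Finset.sum_div]
  refine Finset.sum_congr rfl fun j _ => ?_
  rw [G1_eq]; push_cast; ring

theorem C2_eq (P : Fin 13 → ℤ) (J : ℕ) :
    C2 (fun i => (P i : ℚ) / 10000) J =
      (10000 * (SN P J : ℚ) - FN P J * FN P J) / 10000000000000000 := by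
  unfold C2
  rw [F2_eq]
  have : ∑ i, (P i : ℚ) / 10000 * (G1 (fun i => (P i : ℚ) / 10000) J i *
      G1 (fun i => (P i : ℚ) / 10000) J i) = (SN P J : ℚ) / 1000000000000 := by
    unfold SN
    rw [Int.cast_sum, Finset.sum_div]
    refine Finset.sum_congr rfl fun j _ => ?_
    rw [G1_eq]; push_cast; ring
  rw [this]; ring

variable {V : Type*} [Fintype V] [DecidableEq V] (G : SimpleGraph V) [DecidableRel G.Adj]

theorem F2_le_one {P : Fin 13 → ℤ} (nn : ∀ i, 0 ≤ P i) (sm : ∑ i, P i = 10000) (J : ℕ) :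
    0 ≤ FN P J ∧ FN P J ≤ 100000000 := by
  have hg : ∀ i, 0 ≤ gN P J i ∧ gN P J i ≤ 10000 := by
    intro i
    unfold gN
    refine ⟨Finset.sum_nonneg fun j _ => ?_, ?_⟩
    · have := nn j
      split_ifs <;> omega
    · rw [← sm]
      refine Finset.sum_le_sum fun j _ => ?_
      have := nn j
      split_ifs <;> omega
  unfold FN
  refine ⟨Finset.sum_nonneg fun j _ => mul_nonneg (nn j) (hg j).1, ?_⟩
  calc ∑ i, P i * gN P J i ≤ ∑ i, P i * 10000 :=
        Finset.sum_le_sum fun j _ => mul_le_mul_of_nonneg_left (hg j).2 (nn j)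
    _ = 100000000 := by rw [← Finset.sum_mul, sm]; norm_num

theorem cell_lin {P : Fin 13 → ℤ} {x1 x2 l1 u0 u1 : ℤ} (J : ℕ) {M a b : ℚ} (hM : 0 ≤ M)
    (h1 : x1 * M ≤ 14400 * a) (h2 : 14400 * a ≤ x2 * M) (h3 : l1 * a ≤ 16 * b)
    (h4 : 16 * b ≤ 16 * u0 * M + u1 * a) :
    ((J : ℚ) + 1) / 36 * M + (TN P x1 x2 l1 u0 u1 J + 16588800000 : ℚ) / 23040000000000 * M ≤
      a * (gN P J 0 / 10000) + b * (gN P J 12 / 10000) + (M - a - b) * (FN P J / 100000000) ∧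
    a * (gN P J 0 / 10000) + b * (gN P J 12 / 10000) + (M - a - b) * (FN P J / 100000000) +
      (TN P x1 x2 l1 u0 u1 J + 16588800000 : ℚ) / 23040000000000 * M ≤
      ((J : ℚ) + 12) / 36 * M := by
  generalize hTT : TN P x1 x2 l1 u0 u1 J = TT
  unfold TN at hTT
  generalize gN P J 0 = g0 at *
  generalize gN P J 12 = g12 at *
  generalize FN P J = F at *
  have hb : ∀ X Y : ℤ, TT + 16588800000 ≤ corn J g0 g12 F X Y →
      (0 : ℚ) ≤ (X * 10000 * g0 + Y * 10000 * g12 + (230400 - X - Y) * F -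
        ((J:ℚ) + 1) * 640000000000) - (TT + 16588800000) ∧
      (0 : ℚ) ≤ (((J:ℚ) + 12) * 640000000000 -
        (X * 10000 * g0 + Y * 10000 * g12 + (230400 - X - Y) * F)) - (TT + 16588800000) := by
    intro X Y h
    unfold corn at h
    have e1 := h.trans (min_le_left _ _)
    have e2 := h.trans (min_le_right _ _)
    constructor
    · have := sub_nonneg.2 e1
      exact_mod_cast this
    · have := sub_nonneg.2 e2
      exact_mod_cast this
  have hle : TT + 16588800000 ≤ min (min (corn J g0 g12 F (16 * x1) (l1 * x1))
    (corn J g0 g12 F (16 * x1) (230400 * u0 + u1 * x1)))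
    (min (corn J g0 g12 F (16 * x2) (l1 * x2)) (corn J g0 g12 F (16 * x2) (230400 * u0 + u1 * x2))) := by
    rw [← hTT]; unfold TNa; linarith
  have q := le_min_iff.1 hle
  have q1 := le_min_iff.1 q.1
  have q2 := le_min_iff.1 q.2
  have r1 := hb _ _ q1.1
  have r2 := hb _ _ q1.2
  have r3 := hb _ _ q2.1
  have r4 := hb _ _ q2.2
  push_cast at r1 r2 r3 r4
  constructor
  · have := trap (c0 := F - (((J:ℚ) + 1) * 640000000000 + (TT + 16588800000)) / 230400)
      (c1 := 10000 * g0 - F) (c2 := 10000 * g12 - F) hM h1 h2 h3 h4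
      (by linarith [r1.1]) (by linarith [r2.1]) (by linarith [r3.1]) (by linarith [r4.1])
    linarith
  · have := trap (c0 := (((J:ℚ) + 12) * 640000000000 - (TT + 16588800000)) / 230400 - F)
      (c1 := F - 10000 * g0) (c2 := F - 10000 * g12) hM h1 h2 h3 h4
      (by linarith [r1.2]) (by linarith [r2.2]) (by linarith [r3.2]) (by linarith [r4.2])
    linarith

theorem cell_main {s : ℕ} (hl : 7 * 10 ^ 10 ≤ 3 * s + 1) (hm : G.edgeFinset.card = 3 * s + 1)
    (H H0 : Finset V) (h0 : H0 ⊆ H) (hk : H.card ≤ 10000)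
    (hW : ∑ v ∈ Hᶜ, (dTo G v Hᶜ : ℚ) ^ 2 ≤ 5008 / 100000000 * (3 * s + 1 : ℚ) ^ 2)
    (hsum : (eCr G H0 Hᶜ).card + (eCr G (H \ H0) Hᶜ).card + (eIn G Hᶜ).card + (eIn G H).card =
      3 * s + 1) (hH : (eIn G H).card ≤ 50000000)
    {P : Fin 13 → ℤ} {x1 x2 l1 u0 u1 : ℤ} (hc : CellOK P x1 x2 l1 u0 u1)
    (h1 : x1 * (3 * s + 1) ≤ 14400 * ((eCr G H0 Hᶜ).card : ℤ))
    (h2 : 14400 * ((eCr G H0 Hᶜ).card : ℤ) ≤ x2 * (3 * s + 1))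
    (h3 : l1 * ((eCr G H0 Hᶜ).card : ℤ) ≤ 16 * ((eCr G (H \ H0) Hᶜ).card : ℤ))
    (h4 : 16 * ((eCr G (H \ H0) Hᶜ).card : ℤ) ≤
      16 * u0 * (3 * s + 1) + u1 * ((eCr G H0 Hᶜ).card : ℤ)) :
    ∃ w : V → ℕ, (∀ v, w v ≤ s) ∧ WellGuarded G s w := by
  have hMpos : (70000000000 : ℚ) ≤ 3 * s + 1 := by exact_mod_cast hl
  have lin := fun J : ℕ => cell_lin (P := P) (x1 := x1) (x2 := x2) (l1 := l1) (u0 := u0) (u1 := u1) J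
    (M := 3 * s + 1) (a := (eCr G H0 Hᶜ).card) (b := (eCr G (H \ H0) Hᶜ).card) (by linarith)
    (by exact_mod_cast h1) (by exact_mod_cast h2) (by exact_mod_cast h3) (by exact_mod_cast h4)
  have hsumq : ((eCr G H0 Hᶜ).card : ℚ) + (eCr G (H \ H0) Hᶜ).card + (eIn G Hᶜ).card +
      (eIn G H).card = 3 * s + 1 := by exact_mod_cast hsum
  have hHq : ((eIn G H).card : ℚ) ≤ 50000000 := by exact_mod_cast hH
  have hH0 : (0 : ℚ) ≤ ((eIn G H).card : ℚ) := by positivity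
  refine prob_main G (k := 10000) (by omega) hm H H0 h0 hk (p := fun i => (P i : ℚ) / 10000)
    (fun i => div_nonneg (by exact_mod_cast hc.nn i) (by norm_num)) ?_
    (fun J => (TN P x1 x2 l1 u0 u1 J : ℚ) / 23040000000000 * (3 * s + 1)) ?_ _ hW ?_ ?_ ?_
  · rw [← Finset.sum_div]
    have : ((∑ i, P i : ℤ) : ℚ) = 10000 := by rw [hc.sm]; norm_num
    push_cast at this
    rw [this]; norm_num
  · intro J hJ
    have : (0 : ℚ) < TN P x1 x2 l1 u0 u1 J := by exact_mod_cast hc.tp J hJ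
    positivity
  · have hb : ((∑ J ∈ Finset.range 24, (VN P J * 530841600 / (TN P x1 x2 l1 u0 u1 J) ^ 2 + 1) : ℤ) : ℚ)
        < 1000000 := by exact_mod_cast hc.vs
    rw [Int.cast_sum] at hb
    have hb2 : ∑ J ∈ Finset.range 24, ((VN P J * 530841600 / (TN P x1 x2 l1 u0 u1 J) ^ 2 + 1 : ℤ) : ℚ)
        / 1000000 < 1 := by
      rw [← Finset.sum_div]; rw [div_lt_one (by norm_num)]; exact hb
    refine lt_of_le_of_lt (Finset.sum_le_sum fun J hJ => ?_) hb2
    have tp := hc.tp J (Finset.mem_range.1 hJ)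
    rw [C2_eq]
    have hv : (VN P J : ℚ) = 5008 * (10000 * (SN P J : ℚ) - FN P J * FN P J) + 572000000000000000 := by
      unfold VN; push_cast; ring
    generalize TN P x1 x2 l1 u0 u1 J = t at *
    have tq : (0 : ℚ) < t := by exact_mod_cast tp
    have fl : VN P J * 530841600 < (VN P J * 530841600 / t ^ 2 + 1) * t ^ 2 :=
      Int.lt_ediv_add_one_mul_self _ (by positivity)
    have flq : (VN P J : ℚ) * 530841600 < ((VN P J * 530841600 / t ^ 2 + 1 : ℤ) : ℚ) * (t:ℚ) ^ 2 := by
      exact_mod_cast fl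
    generalize ((VN P J * 530841600 / t ^ 2 + 1 : ℤ) : ℚ) = q at *
    have hD : 10000 * (SN P J : ℚ) - FN P J * FN P J = (VN P J - 572000000000000000) / 5008 := by
      rw [hv]; ring
    rw [hD]
    generalize (VN P J : ℚ) = v at *
    push_cast
    generalize (3 * s + 1 : ℚ) = M at *
    have hMp : 0 < M := by linarith
    rw [div_le_iff₀ (by positivity)]
    have e1 : 40001 * M ≤ 572 / 1000000000 * M ^ 2 := by
      have := mul_le_mul_of_nonneg_right hMpos hMp.le
      linarith [sq M]
    have e2 : q / 1000000 * (t / 23040000000000 * M) ^ 2 =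
      (q * (t:ℚ) ^ 2) * (M ^ 2 / (1000000 * 23040000000000 ^ 2)) := by ring
    rw [e2]
    have e3 := mul_le_mul_of_nonneg_right flq.le
      (show 0 ≤ M ^ 2 / (1000000 * 23040000000000 ^ 2) by positivity)
    refine le_trans ?_ e3
    linarith
  · intro J hJ
    have := (lin J).1
    obtain ⟨f0, f1⟩ := F2_le_one hc.nn hc.sm J
    have f0q : (0 : ℚ) ≤ FN P J := by exact_mod_cast f0
    have f1q : (FN P J : ℚ) ≤ 100000000 := by exact_mod_cast f1
    rw [G1_eq, G1_eq, F2_eq]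
    beta_reduce
    have e := mul_le_mul_of_nonneg_left f1q hH0
    rw [show ((eIn G Hᶜ).card : ℚ) = (3 * s + 1 - (eCr G H0 Hᶜ).card - (eCr G (H \ H0) Hᶜ).card) - (eIn G H).card by
      linarith]
    linarith
  · intro J hJ
    have := (lin J).2
    obtain ⟨f0, f1⟩ := F2_le_one hc.nn hc.sm J
    have f0q : (0 : ℚ) ≤ FN P J := by exact_mod_cast f0
    rw [G1_eq, G1_eq, F2_eq]
    beta_reduce
    have e := mul_nonneg hH0 f0q
    rw [show ((eIn G Hᶜ).card : ℚ) = (3 * s + 1 - (eCr G H0 Hᶜ).card - (eCr G (H \ H0) Hᶜ).card) - (eIn G H).card by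
      linarith]
    linarith

theorem cell1 : CellOK ![2530, 330, 360, 400, 430, 430, 420, 390, 340, 300, 350, 410, 3310]
    0 3600 0 0 16 :=
  ⟨by decide +kernel, by decide +kernel, by decide +kernel, by decide +kernel⟩

theorem cell2 : CellOK ![1430, 560, 600, 610, 590, 580, 560, 510, 430, 380, 370, 420, 2960]
    3600 7200 8 0 16 :=
  ⟨by decide +kernel, by decide +kernel, by decide +kernel, by decide +kernel⟩

theorem cell3 : CellOK ![680, 590, 590, 600, 600, 600, 600, 590, 590, 590, 580, 580, 2810]
    7200 8640 8 1 (-16) :=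
  ⟨by decide +kernel, by decide +kernel, by decide +kernel, by decide +kernel⟩

theorem cell4 : CellOK ![530, 530, 510, 490, 480, 480, 480, 480, 480, 480, 480, 480, 4100]
    8640 9072 8 1 (-16) :=
  ⟨by decide +kernel, by decide +kernel, by decide +kernel, by decide +kernel⟩

theorem cell5 : CellOK ![1890, 340, 370, 420, 460, 470, 470, 460, 430, 390, 360, 340, 3600]
    3600 5040 0 0 8 :=
  ⟨by decide +kernel, by decide +kernel, by decide +kernel, by decide +kernel⟩

theorem cell6 : CellOK ![1530, 350, 400, 450, 480, 490, 490, 480, 460, 430, 400, 380, 3660]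
    5040 5760 0 0 8 :=
  ⟨by decide +kernel, by decide +kernel, by decide +kernel, by decide +kernel⟩

theorem cell7 : CellOK ![1000, 510, 530, 530, 530, 520, 510, 480, 450, 420, 400, 380, 3740]
    5760 7200 4 0 8 :=
  ⟨by decide +kernel, by decide +kernel, by decide +kernel, by decide +kernel⟩

theorem cell8 : CellOK ![680, 520, 520, 520, 510, 500, 480, 470, 450, 440, 430, 420, 4060]
    7200 8000 4 0 8 :=
  ⟨by decide +kernel, by decide +kernel, by decide +kernel, by decide +kernel⟩

theorem cell9 : CellOK ![1180, 400, 450, 470, 480, 470, 470, 450, 420, 390, 370, 360, 4090]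
    5760 6480 0 0 4 :=
  ⟨by decide +kernel, by decide +kernel, by decide +kernel, by decide +kernel⟩

theorem cell10 : CellOK ![870, 440, 480, 490, 480, 480, 460, 440, 410, 390, 380, 370, 4310]
    6480 7200 0 0 4 :=
  ⟨by decide +kernel, by decide +kernel, by decide +kernel, by decide +kernel⟩

theorem cell11 : CellOK ![680, 470, 480, 480, 480, 470, 450, 420, 410, 390, 380, 370, 4520]
    7200 7632 0 0 4 :=
  ⟨by decide +kernel, by decide +kernel, by decide +kernel, by decide +kernel⟩

theorem cell12 : CellOK ![620, 490, 480, 480, 470, 460, 440, 420, 410, 390, 380, 380, 4580]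
    7632 8000 2 0 4 :=
  ⟨by decide +kernel, by decide +kernel, by decide +kernel, by decide +kernel⟩

theorem cell13 : CellOK ![640, 460, 460, 460, 460, 440, 420, 400, 390, 380, 370, 360, 4760]
    7632 7776 0 0 2 :=
  ⟨by decide +kernel, by decide +kernel, by decide +kernel, by decide +kernel⟩

theorem cell14 : CellOK ![600, 470, 470, 460, 450, 440, 420, 400, 390, 380, 370, 360, 4790]
    7776 8000 1 0 2 :=
  ⟨by decide +kernel, by decide +kernel, by decide +kernel, by decide +kernel⟩

theorem cell15 : CellOK ![580, 470, 460, 460, 450, 430, 410, 390, 380, 370, 360, 350, 4890]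
    7776 8000 0 0 1 :=
  ⟨by decide +kernel, by decide +kernel, by decide +kernel, by decide +kernel⟩

end Cells

/-! ### assembly -/
section Asm
variable {V : Type*} [Fintype V] [DecidableEq V] (G : SimpleGraph V) [DecidableRel G.Adj]

theorem split_lemma (d : V → ℕ) (H : Finset V) : ∃ H0 ⊆ H, ∃ a b : ℕ,
    a = ∑ v ∈ H0, d v ∧ b = ∑ v ∈ H \ H0, d v ∧ b ≤ a ∧
    (a = 0 ∨ (∃ h ∈ H0, a = d h) ∨ (a ≤ 2 * b ∧ (2 * a ≤ 3 * b ∨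
      ∃ x y z : V, x ∈ H ∧ y ∈ H ∧ z ∈ H ∧ x ≠ y ∧ x ≠ z ∧ y ≠ z ∧ d x ≤ b ∧ d y ≤ b ∧ d z ≤ b ∧
        3 * a ≤ 2 * (d x + d y + d z)))) := by
  obtain ⟨H0, hH0, hmin⟩ := Finset.exists_min_image
    (H.powerset.filter (fun S => ∑ v ∈ H, d v ≤ 2 * ∑ v ∈ S, d v)) (fun S => ∑ v ∈ S, d v)
    ⟨H, by rw [Finset.mem_filter, Finset.mem_powerset]; exact ⟨subset_rfl, by omega⟩⟩
  rw [Finset.mem_filter, Finset.mem_powerset] at hH0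
  obtain ⟨hsub, hhalf⟩ := hH0
  have htot := Finset.sum_sdiff hsub (f := d)
  set a := ∑ v ∈ H0, d v with ha
  set b := ∑ v ∈ H \ H0, d v with hb
  have K : ∀ S ⊆ H, ∑ v ∈ S, d v ≤ b ∨ a ≤ ∑ v ∈ S, d v := by
    intro S hS
    by_cases h : ∑ v ∈ H, d v ≤ 2 * ∑ v ∈ S, d v
    · right
      exact hmin S (by rw [Finset.mem_filter, Finset.mem_powerset]; exact ⟨hS, h⟩)
    · left
      have h2 := Finset.sum_sdiff hS (f := d)
      have h3 := hmin (H \ S) (by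
        rw [Finset.mem_filter, Finset.mem_powerset]; exact ⟨Finset.sdiff_subset, by omega⟩)
      change a ≤ _ at h3
      omega
  have hp : ∀ h ∈ H0, 0 < d h → a ≤ b + d h := by
    intro h hh h0
    have e := Finset.add_sum_erase H0 d hh
    rcases K (H0.erase h) ((Finset.erase_subset _ _).trans hsub) with k | k <;> omega
  refine ⟨H0, hsub, a, b, ha, hb, by omega, ?_⟩
  set Q := H0.filter (fun v => 0 < d v) with hQ
  have haQ : a = ∑ v ∈ Q, d v := by
    rw [hQ, Finset.sum_filter, ha]
    refine Finset.sum_congr rfl fun v _ => ?_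
    split_ifs <;> omega
  have hQm : ∀ x ∈ Q, x ∈ H0 ∧ 0 < d x := fun x hx => Finset.mem_filter.1 hx
  rcases Nat.lt_or_ge Q.card 1 with h1 | h1
  · left
    rw [haQ, Finset.card_eq_zero.1 (by omega : Q.card = 0)]; rfl
  rcases Nat.lt_or_ge Q.card 2 with h2 | h2
  · right; left
    obtain ⟨h, hh⟩ := Finset.card_eq_one.1 (by omega : Q.card = 1)
    refine ⟨h, (hQm h (by rw [hh]; simp)).1, ?_⟩
    rw [haQ, hh, Finset.sum_singleton]
  right; right
  rcases Nat.lt_or_ge Q.card 3 with h3 | h3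
  · obtain ⟨x, y, hxy, hh⟩ := Finset.card_eq_two.1 (by omega : Q.card = 2)
    have hx := hQm x (by rw [hh]; simp)
    have hy := hQm y (by rw [hh]; simp)
    have hax := hp x hx.1 hx.2
    have hay := hp y hy.1 hy.2
    have hsum : a = d x + d y := by rw [haQ, hh, Finset.sum_pair hxy]
    refine ⟨by omega, ?_⟩
    by_cases h23 : 2 * a ≤ 3 * b
    · exact Or.inl h23
    right
    obtain ⟨S, hS, hSmin⟩ := Finset.exists_min_image
      ((H \ H0).powerset.filter (fun S => b < d x + ∑ v ∈ S, d v)) Finset.card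
      ⟨H \ H0, by rw [Finset.mem_filter, Finset.mem_powerset]; exact ⟨subset_rfl, by omega⟩⟩
    rw [Finset.mem_filter, Finset.mem_powerset] at hS
    have hne : S.Nonempty := by
      rw [Finset.nonempty_iff_ne_empty]
      rintro rfl
      have := hS.2
      rw [Finset.sum_empty] at this
      omega
    obtain ⟨z, hz⟩ := hne
    have hz1 := hS.1 hz
    rw [Finset.mem_sdiff] at hz1
    have hxz : x ≠ z := by rintro rfl; exact hz1.2 hx.1
    have hyz : y ≠ z := by rintro rfl; exact hz1.2 hy.1
    have hzb : d z ≤ b := Finset.single_le_sum (f := d) (fun _ _ => Nat.zero_le _) (hS.1 hz)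
    have hxS : x ∉ S := fun h => (Finset.mem_sdiff.1 (hS.1 h)).2 hx.1
    have e1 : a ≤ d x + ∑ v ∈ S, d v := by
      have hi := Finset.sum_insert (f := d) hxS
      rcases K (insert x S) (Finset.insert_subset (hsub hx.1) (hS.1.trans Finset.sdiff_subset))
        with k | k
      · have := hS.2; omega
      · omega
    have e2 : d x + ∑ v ∈ S.erase z, d v ≤ b := by
      by_contra hcon
      have := hSmin (S.erase z) (by
        rw [Finset.mem_filter, Finset.mem_powerset]
        exact ⟨(Finset.erase_subset _ _).trans hS.1, by omega⟩)
      have h5 := Finset.card_erase_lt_of_mem hz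
      omega
    have e3 := Finset.add_sum_erase S d hz
    have swap : ∀ q ∈ H0, d z < d q → a + d z ≤ b + d q := by
      intro q hq hlt
      have f1 := Finset.add_sum_erase H0 d hq
      have f2 : z ∉ H0.erase q := fun h => hz1.2 (Finset.mem_of_mem_erase h)
      have f3 := Finset.sum_insert (f := d) f2
      rcases K (insert z (H0.erase q)) (Finset.insert_subset hz1.1
        ((Finset.erase_subset _ _).trans hsub)) with k | k <;> omega
    have sx : d x ≤ d z := by
      by_contra hcon
      have := swap x hx.1 (by omega)
      omega
    have sy : d y ≤ d z := by
      by_contra hcon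
      have := swap y hy.1 (by omega)
      omega
    exact ⟨x, y, z, hsub hx.1, hsub hy.1, hz1.1, hxy, hxz, hyz, by omega, by omega, hzb, by omega⟩
  · obtain ⟨R, hR, hRc⟩ := Finset.exists_subset_card_eq h3
    obtain ⟨x, y, z, hxy, hxz, hyz, hh⟩ := Finset.card_eq_three.1 hRc
    have hx := hQm x (hR (by rw [hh]; simp))
    have hy := hQm y (hR (by rw [hh]; simp))
    have hz := hQm z (hR (by rw [hh]; simp))
    have hax := hp x hx.1 hx.2
    have hay := hp y hy.1 hy.2
    have haz := hp z hz.1 hz.2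
    have hle : ∑ v ∈ R, d v ≤ a := by
      rw [haQ]; exact Finset.sum_le_sum_of_subset hR
    have hsum : ∑ v ∈ R, d v = d x + (d y + d z) := by
      rw [hh, Finset.sum_insert (by simp [hxy, hxz]), Finset.sum_pair hyz]
    exact ⟨by omega, Or.inl (by omega)⟩

theorem regionD {s : ℕ} (hl : 7 * 10 ^ 10 ≤ 3 * s + 1) (hm : G.edgeFinset.card = 3 * s + 1)
    (H H0 : Finset V) (h0 : H0 ⊆ H) (hk : H.card ≤ 10000)
    (hW : ∑ v ∈ Hᶜ, (dTo G v Hᶜ : ℚ) ^ 2 ≤ 5008 / 100000000 * (3 * s + 1 : ℚ) ^ 2)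
    (hsum : (eCr G H0 Hᶜ).card + (eCr G (H \ H0) Hᶜ).card + (eIn G Hᶜ).card + (eIn G H).card =
      3 * s + 1) (hH : (eIn G H).card ≤ 50000000)
    (hba : (eCr G (H \ H0) Hᶜ).card ≤ (eCr G H0 Hᶜ).card)
    (hreg : 9 * (eCr G H0 Hᶜ).card ≤ 5 * (3 * s + 1) ∨
      ((eCr G H0 Hᶜ).card ≤ 2 * (eCr G (H \ H0) Hᶜ).card ∧
        100 * (eCr G H0 Hᶜ).card ≤ 63 * (3 * s + 1))) :
    ∃ w : V → ℕ, (∀ v, w v ≤ s) ∧ WellGuarded G s w := by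
  have key := @cell_main V _ _ G _ s hl hm H H0 h0 hk hW hsum hH
  generalize (eCr G H0 Hᶜ).card = a at *
  generalize (eCr G (H \ H0) Hᶜ).card = b at *
  by_cases c1 : 4 * a ≤ 3 * s + 1
  · exact key cell1 (by omega) (by omega) (by omega) (by omega)
  by_cases d2 : a ≤ 2 * b
  · by_cases c2 : 2 * a ≤ 3 * s + 1
    · exact key cell2 (by omega) (by omega) (by omega) (by omega)
    by_cases c3 : 5 * a ≤ 3 * (3 * s + 1)
    · exact key cell3 (by omega) (by omega) (by omega) (by omega)
    · exact key cell4 (by omega) (by omega) (by omega) (by omega)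
  by_cases c5 : 20 * a ≤ 7 * (3 * s + 1)
  · exact key cell5 (by omega) (by omega) (by omega) (by omega)
  by_cases c6 : 5 * a ≤ 2 * (3 * s + 1)
  · exact key cell6 (by omega) (by omega) (by omega) (by omega)
  by_cases d4 : a ≤ 4 * b
  · by_cases c7 : 2 * a ≤ 3 * s + 1
    · exact key cell7 (by omega) (by omega) (by omega) (by omega)
    · exact key cell8 (by omega) (by omega) (by omega) (by omega)
  by_cases c9 : 20 * a ≤ 9 * (3 * s + 1)
  · exact key cell9 (by omega) (by omega) (by omega) (by omega)
  by_cases c10 : 2 * a ≤ 3 * s + 1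
  · exact key cell10 (by omega) (by omega) (by omega) (by omega)
  by_cases c11 : 100 * a ≤ 53 * (3 * s + 1)
  · exact key cell11 (by omega) (by omega) (by omega) (by omega)
  by_cases d8 : a ≤ 8 * b
  · exact key cell12 (by omega) (by omega) (by omega) (by omega)
  by_cases c13 : 100 * a ≤ 54 * (3 * s + 1)
  · exact key cell13 (by omega) (by omega) (by omega) (by omega)
  by_cases d16 : a ≤ 16 * b
  · exact key cell14 (by omega) (by omega) (by omega) (by omega)
  · exact key cell15 (by omega) (by omega) (by omega) (by omega)

theorem eIn_le_sq (A : Finset V) : 2 * (eIn G A).card ≤ A.card * A.card := by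
  rw [← sum_dTo_self]
  calc ∑ v ∈ A, dTo G v A ≤ ∑ _v ∈ A, A.card := Finset.sum_le_sum fun v _ => dTo_le_card G v A
    _ = A.card * A.card := by rw [Finset.sum_const, smul_eq_mul]

theorem main_thm {s : ℕ} (hl : 7 * 10 ^ 10 ≤ 3 * s + 1) (hm : G.edgeFinset.card = 3 * s + 1)
    (hD : ∀ v, G.degree v ≤ 2 * s) :
    ∃ w : V → ℕ, (∀ v, w v ≤ s) ∧ WellGuarded G s w := by
  by_cases hbig : ∃ c, 5 * s ≤ 3 * G.degree c
  · obtain ⟨c, hc⟩ := hbig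
    exact regime1 G (by omega) hm c (hD c) hc
  push Not at hbig
  have hV : 10000 ≤ (Finset.univ : Finset V).card := by
    by_contra hcon
    have := eIn_le_sq G Finset.univ
    rw [eIn_univ, hm] at this
    have h2 : (Finset.univ : Finset V).card * (Finset.univ : Finset V).card ≤ 10000 * 10000 :=
      Nat.mul_le_mul (by omega) (by omega)
    omega
  obtain ⟨ρ, _, r2, r3⟩ := exists_rank (Finset.univ : Finset V) (fun v => G.degree v)
  set n := (Finset.univ : Finset V).card with hn
  set L := Finset.univ.filter (fun x => ρ x < n - 10000) with hL
  have hLc : L.card = n - 10000 := r2 _ (by omega)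
  set H := Lᶜ with hHdef
  have hHL : Hᶜ = L := by rw [hHdef, compl_compl]
  have hHc : H.card = 10000 := by
    rw [hHdef, Finset.card_compl, hLc, ← Finset.card_univ]; omega
  have hdeg : ∀ v ∈ Hᶜ, ∀ h ∈ H, G.degree v ≤ G.degree h := by
    intro v hv h hh
    rw [hHL, hL, Finset.mem_filter] at hv
    rw [hHdef, Finset.mem_compl, hL, Finset.mem_filter] at hh
    refine r3 v (Finset.mem_univ _) h (Finset.mem_univ _) ?_
    have : ¬ ρ h < n - 10000 := fun h' => hh ⟨Finset.mem_univ _, h'⟩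
    omega
  have heH : (eIn G H).card ≤ 50000000 := by
    have := eIn_le_sq G H
    rw [hHc] at this; omega
  have hdisj : Disjoint H Hᶜ := disjoint_compl_right
  have hun : H ∪ Hᶜ = Finset.univ := Finset.union_compl H
  have htot : (eIn G H).card + (eIn G Hᶜ).card + ∑ v ∈ H, dTo G v Hᶜ = 3 * s + 1 := by
    rw [← hm, ← eIn_univ, ← hun, card_eIn_union G hdisj]
  have hdd : ∀ v, G.degree v = dTo G v H + dTo G v Hᶜ := by
    intro v
    rw [← dTo_univ, ← hun, dTo_union G v hdisj]
  have hsumdeg : ∑ h ∈ H, G.degree h = 2 * (eIn G H).card + ∑ v ∈ H, dTo G v Hᶜ := by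
    rw [← sum_dTo_self, ← Finset.sum_add_distrib]
    exact Finset.sum_congr rfl fun v _ => hdd v
  have hmaxL : ∀ v ∈ Hᶜ, 10000 * dTo G v Hᶜ ≤ 3 * s + 1 + (eIn G H).card - (eIn G Hᶜ).card := by
    intro v hv
    have h1 : H.card • dTo G v Hᶜ ≤ ∑ h ∈ H, G.degree h :=
      Finset.card_nsmul_le_sum _ _ _ fun h hh => by
        have := hdeg v hv h hh
        have := hdd v
        omega
    rw [hHc, smul_eq_mul] at h1
    omega
  have hW : ∑ v ∈ Hᶜ, (dTo G v Hᶜ : ℚ) ^ 2 ≤ 5008 / 100000000 * (3 * s + 1 : ℚ) ^ 2 := by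
    have h1 : ∑ v ∈ Hᶜ, (dTo G v Hᶜ : ℚ) ^ 2 ≤ ∑ v ∈ Hᶜ,
        (dTo G v Hᶜ : ℚ) * (((3 * s + 1 : ℚ) + (eIn G H).card - (eIn G Hᶜ).card) / 10000) := by
      refine Finset.sum_le_sum fun v hv => ?_
      rw [sq]
      refine mul_le_mul_of_nonneg_left ?_ (Nat.cast_nonneg _)
      rw [le_div_iff₀ (by norm_num)]
      have h2 : dTo G v Hᶜ * 10000 + (eIn G Hᶜ).card ≤ 3 * s + 1 + (eIn G H).card := by
        have := hmaxL v hv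
        omega
      have h3 : (dTo G v Hᶜ * 10000 + (eIn G Hᶜ).card : ℚ) ≤ 3 * s + 1 + (eIn G H).card := by
        exact_mod_cast h2
      linarith
    refine h1.trans ?_
    rw [← Finset.sum_mul]
    have h2 : (∑ v ∈ Hᶜ, (dTo G v Hᶜ : ℚ)) = 2 * (eIn G Hᶜ).card := by
      exact_mod_cast sum_dTo_self G Hᶜ
    rw [h2]
    have h3 : ((eIn G H).card : ℚ) ≤ 50000000 := by exact_mod_cast heH
    have h4 : (70000000000 : ℚ) ≤ 3 * s + 1 := by exact_mod_cast hl
    have h5 : (0 : ℚ) ≤ (eIn G H).card := Nat.cast_nonneg _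
    generalize ((eIn G H).card : ℚ) = e at *
    generalize ((eIn G Hᶜ).card : ℚ) = g at *
    generalize (3 * s + 1 : ℚ) = M at *
    have h6 : 0 ≤ (M + e - 2 * g) ^ 2 := sq_nonneg _
    have h7 : (M + e) ^ 2 ≤ (M + M / 1400) ^ 2 := by
      apply pow_le_pow_left₀ (by linarith); linarith
    have h8 : 0 ≤ M ^ 2 := sq_nonneg _
    linarith
  obtain ⟨H0, h0, a, b, ha, hb, hba, hcase⟩ := split_lemma (fun v => dTo G v Hᶜ) H
  have hspl := Finset.sum_sdiff h0 (f := fun v => dTo G v Hᶜ)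
  have hd0 : Disjoint H0 Hᶜ := hdisj.mono_left h0
  have hd1 : Disjoint (H \ H0) Hᶜ := hdisj.mono_left Finset.sdiff_subset
  have hca : (eCr G H0 Hᶜ).card = a := by rw [card_eCr G hd0, ha]
  have hcb : (eCr G (H \ H0) Hᶜ).card = b := by rw [card_eCr G hd1, hb]
  have hsum : (eCr G H0 Hᶜ).card + (eCr G (H \ H0) Hᶜ).card + (eIn G Hᶜ).card + (eIn G H).card =
      3 * s + 1 := by
    rw [hca, hcb]; rw [← ha, ← hb] at hspl; omega
  have fin := fun hreg => regionD G hl hm H H0 h0 hHc.le hW hsum heH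
    (by rw [hca, hcb]; exact hba) hreg
  rw [hca, hcb] at fin
  rcases hcase with hc | ⟨h, _, hc⟩ | ⟨hc, hc'⟩
  · exact fin (Or.inl (by omega))
  · refine fin (Or.inl ?_)
    have := hbig h
    have := hdd h
    omega
  · by_cases h63 : 100 * a ≤ 63 * (3 * s + 1)
    · exact fin (Or.inr ⟨hc, h63⟩)
    rw [hca, hcb] at hsum
    rcases hc' with hc' | ⟨x, y, z, hx, hy, hz, hxy, hxz, hyz, bx, by', bz, h3a⟩
    · omega
    set V' := (Finset.univ : Finset V) \ {x, y, z} with hV'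
    have hsub : Hᶜ ⊆ V' := by
      intro v hv
      rw [hV', Finset.mem_sdiff]
      refine ⟨Finset.mem_univ _, ?_⟩
      rw [Finset.mem_compl] at hv
      simp only [Finset.mem_insert, Finset.mem_singleton]
      rintro (rfl | rfl | rfl)
      · exact hv hx
      · exact hv hy
      · exact hv hz
    have hlow : ∀ v, dTo G v Hᶜ ≤ dTo G v V' := fun v => dTo_mono G v hsub
    have hup : ∀ v, dTo G v V' ≤ dTo G v Hᶜ + 10000 := by
      intro v
      have h1 := dTo_mono G v (Finset.subset_univ V')
      rw [dTo_univ, hdd v] at h1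
      have h2 := dTo_le_card G v H
      omega
    have hdis : Disjoint ({x, y, z} : Finset V) V' := Finset.disjoint_sdiff
    have h5 := card_eIn_union G hdis
    rw [hV', Finset.union_sdiff_of_subset (Finset.subset_univ _), ← hV', eIn_univ, hm,
      Finset.sum_insert (by simp [hxy, hxz]), Finset.sum_pair hyz] at h5
    have l1 := hlow x
    have l2 := hlow y
    have l3 := hlow z
    have u1 := hup x
    have u2 := hup y
    have u3 := hup z
    exact regime3 G (by omega) hm x y z hxy hxz hyz V' hV' (by omega) (by omega) (by omega)
      (by omega)
end Asm

/-- If `G` is a finite simple graph with `m = 3s+1 ≥ 7·10^10` edges and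
maximum degree at most `2s`, then `G` admits a well guarded weighting
`w : V → {0, 1, …, s}`. -/
theorem exists_wellGuarded {V : Type*} [Fintype V] [DecidableEq V]
    (G : SimpleGraph V) [DecidableRel G.Adj]
    (m s : ℕ) (hm : m = G.edgeSet.ncard) (hs : m = 3 * s + 1)
    (hlarge : 7 * 10 ^ 10 ≤ m) (hΔ : G.maxDegree ≤ 2 * s) :
    ∃ w : V → ℕ, (∀ v, w v ≤ s) ∧ WellGuarded G s w := by
  refine main_thm G (s := s) (by omega) ?_ (fun v => (G.degree_le_maxDegree v).trans hΔ)
  rw [← hs, hm, ← SimpleGraph.coe_edgeFinset, Set.ncard_coe_finset]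
end

section
/- Let G = (V,E) be a finite simple graph with m := |E| ≥ 7·10^10 edges and m ≡ 1 (mod 3); set s := (m−1)/3, ε := 2.7·10⁻⁵, B := {v ∈ V : d(v) > εm} and V' := V ∖ B. Let v1, v2, v3 be three distinct vertices with v2, v3 ∈ B and d(v1) = Δ the maximum degree of G; let H := G − {v1,v2,v3}, let dᵢ := |E(vᵢ, V(H))| for 1 ≤ i ≤ 3, and assume d1 ≥ d2 ≥ d3, d2 + d3 > 0.51·m, and Δ ≤ 2s. Then there exists a set X ⊆ V' such that |E(X, {v2,v3})| ≥ s + 2 and |E(X)| ≤ max{ 0.5·s − (d2 + d3 − |B|)/4 + 1.5 , 1.5·s − (d1 + 2d2 + 2d3)/3 + 2.5 }. -/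
open SimpleGraph

/-- `E(X)` : the set of edges of `G` with both endpoints in `X`. -/
def edgesWithin {V : Type*} (G : SimpleGraph V) (X : Set V) : Set (Sym2 V) :=
  {e ∈ G.edgeSet | ∀ v ∈ e, v ∈ X}

/-- `E(X, Y)` : the set of edges of `G` with one endpoint in `X` and one endpoint in `Y`. -/
def edgesBetween {V : Type*} (G : SimpleGraph V) (X Y : Set V) : Set (Sym2 V) :=
  {e : Sym2 V | ∃ x ∈ X, ∃ y ∈ Y, G.Adj x y ∧ e = s(x, y)}

section helpers

variable {V : Type*} [DecidableEq V]

/-- number of `Y`-neighbours -/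
def dg (G : SimpleGraph V) [DecidableRel G.Adj] (Y : Finset V) (x : V) : ℕ :=
  ∑ y ∈ Y, if G.Adj x y then 1 else 0

/-- twice the number of edges -/
def dd (G : SimpleGraph V) [DecidableRel G.Adj] (X : Finset V) : ℕ :=
  ∑ x ∈ X, dg G X x

theorem dg_swap (G : SimpleGraph V) [DecidableRel G.Adj] (X Y : Finset V) :
    ∑ x ∈ X, dg G Y x = ∑ y ∈ Y, dg G X y := by
  unfold dg
  rw [Finset.sum_comm]
  simp only [G.adj_comm]

theorem dg_le_card (G : SimpleGraph V) [DecidableRel G.Adj] (Y : Finset V) (x : V) :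
    dg G Y x ≤ Y.card := by
  unfold dg
  rw [Finset.card_eq_sum_ones]
  apply Finset.sum_le_sum
  intro i _
  split_ifs <;> omega

theorem dg_union (G : SimpleGraph V) [DecidableRel G.Adj] (Y Z : Finset V) (h : Disjoint Y Z)
    (x : V) : dg G (Y ∪ Z) x = dg G Y x + dg G Z x := by
  unfold dg
  rw [Finset.sum_union h]

theorem dd_union (G : SimpleGraph V) [DecidableRel G.Adj] (Y Z : Finset V) (h : Disjoint Y Z) :
    dd G (Y ∪ Z) = dd G Y + dd G Z + 2 * ∑ z ∈ Z, dg G Y z := by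
  unfold dd
  rw [Finset.sum_union h]
  simp only [dg_union G Y Z h, Finset.sum_add_distrib]
  rw [dg_swap G Y Z]
  ring

theorem dd_erase (G : SimpleGraph V) [DecidableRel G.Adj] (X : Finset V) (x : V) (hx : x ∈ X) :
    dd G (X.erase x) + 2 * dg G X x = dd G X := by
  have h := dd_union G (X.erase x) {x} (by simp)
  have e : X.erase x ∪ {x} = X := by
    ext y; by_cases hy : y = x <;> simp [hy, hx]
  have h2 := dg_union G (X.erase x) {x} (by simp) x
  rw [e] at h h2
  have h3 : dg G {x} x = 0 := by unfold dg; rw [Finset.sum_singleton]; simp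
  have h4 : dd G {x} = 0 := by unfold dd; rw [Finset.sum_singleton, h3]
  rw [h4, Finset.sum_singleton] at h
  omega

theorem stepB (G : SimpleGraph V) [DecidableRel G.Adj] (w : V → ℕ) (hw : ∀ x, w x ≤ 2) (K : ℕ)
    (X : Finset V) (hK : K ≤ ∑ x ∈ X, w x) :
    ∃ Y ⊆ X, K ≤ ∑ x ∈ Y, w x ∧
      (dd G Y = 0 ∨ dd G Y + ∑ x ∈ X, w x ≤ dd G X + K + 1) := by
  induction X using Finset.strongInduction with
  | H X ih =>
    by_cases h0 : dd G X = 0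
    · exact ⟨X, subset_rfl, hK, Or.inl h0⟩
    by_cases h1 : ∑ x ∈ X, w x ≤ K + 1
    · exact ⟨X, subset_rfl, hK, Or.inr (by omega)⟩
    obtain ⟨x, hx, hdx⟩ : ∃ x ∈ X, dg G X x ≠ 0 := by
      by_contra! hc
      exact h0 (Finset.sum_eq_zero hc)
    have he := dd_erase G X x hx
    have hs := Finset.sum_erase_add X w hx
    have hwx := hw x
    obtain ⟨Y, hY, hYK, hY2⟩ := ih (X.erase x) (Finset.erase_ssubset hx) (by omega)
    refine ⟨Y, hY.trans (Finset.erase_subset _ _), hYK, ?_⟩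
    rcases hY2 with h | h
    · exact Or.inl h
    · right; omega

theorem stepA (G : SimpleGraph V) [DecidableRel G.Adj] (w : V → ℕ) (hw : ∀ x, w x ≤ 2) (K : ℕ)
    (X : Finset V) (hK : K ≤ ∑ x ∈ X, w x)
    (hJ : 2 * dd G X + 3 * (K + 1) ≤ 4 * ∑ x ∈ X, w x) :
    ∃ Y ⊆ X, K ≤ ∑ x ∈ Y, w x ∧ 2 * dd G Y ≤ ∑ x ∈ Y, w x ∧
      dd G Y + 2 * ∑ x ∈ X, w x ≤ dd G X + 2 * ∑ x ∈ Y, w x := by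
  induction X using Finset.strongInduction with
  | H X ih =>
    by_cases h0 : 2 * dd G X ≤ ∑ x ∈ X, w x
    · exact ⟨X, subset_rfl, hK, h0, le_rfl⟩
    obtain ⟨x, hx, hdx⟩ : ∃ x ∈ X, w x ≤ dg G X x := by
      by_contra! hc
      apply h0
      unfold dd
      rw [Finset.mul_sum]
      apply Finset.sum_le_sum
      intro x hx
      have := hc x hx
      have := hw x
      omega
    have he := dd_erase G X x hx
    have hs := Finset.sum_erase_add X w hx
    have hwx := hw x
    obtain ⟨Y, hY, hYK, hY2, hY3⟩ :=
      ih (X.erase x) (Finset.erase_ssubset hx) (by omega) (by omega)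
    exact ⟨Y, hY.trans (Finset.erase_subset _ _), hYK, hY2, by omega⟩

theorem dd_univ [Fintype V] (G : SimpleGraph V) [DecidableRel G.Adj] :
    dd G Finset.univ = 2 * G.edgeSet.ncard := by
  have h := G.sum_degrees_eq_twice_card_edges
  have h2 : G.edgeSet.ncard = G.edgeFinset.card := by
    rw [← SimpleGraph.coe_edgeFinset, Set.ncard_coe_finset]
  rw [h2, ← h]
  unfold dd dg
  apply Finset.sum_congr rfl
  intro x _
  rw [← SimpleGraph.card_neighborFinset_eq_degree, SimpleGraph.neighborFinset_eq_filter,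
    Finset.card_filter]

theorem dg_univ [Fintype V] (G : SimpleGraph V) [DecidableRel G.Adj] (x : V) :
    dg G Finset.univ x = G.degree x := by
  unfold dg
  rw [← SimpleGraph.card_neighborFinset_eq_degree, SimpleGraph.neighborFinset_eq_filter,
    Finset.card_filter]

theorem dd_within [Fintype V] (G : SimpleGraph V) [DecidableRel G.Adj] (X : Finset V) :
    2 * (edgesWithin G (X : Set V)).ncard = dd G X := by
  classical
  let G' : SimpleGraph V :=
    { Adj := fun x y => G.Adj x y ∧ x ∈ X ∧ y ∈ X
      symm := ⟨fun x y h => ⟨h.1.symm, h.2.2, h.2.1⟩⟩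
      loopless := ⟨fun x h => G.loopless.irrefl x h.1⟩ }
  have h := dd_univ G'
  have e : G'.edgeSet = edgesWithin G (X : Set V) := by
    ext z
    induction z using Sym2.ind with
    | _ x y =>
      simp [edgesWithin, G', SimpleGraph.mem_edgeSet]
  rw [← e, ← h]
  unfold dd dg
  have h1 : ∀ x : V, (∑ y : V, if G'.Adj x y then 1 else 0) =
      if x ∈ X then ∑ y ∈ X, (if G.Adj x y then 1 else 0) else 0 := by
    intro x
    by_cases hx : x ∈ X
    · rw [if_pos hx, ← Finset.sum_subset (Finset.subset_univ X)]
      · apply Finset.sum_congr rfl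
        intro y hy
        simp [G', hx, hy]
      · intro y _ hy
        simp [G', hy]
    · simp [G', hx]
  rw [Finset.sum_congr rfl (fun x _ => h1 x)]
  simp

theorem dg_between [Fintype V] (G : SimpleGraph V) [DecidableRel G.Adj] (v : V) (R : Finset V) :
    (edgesBetween G {v} (R : Set V)).ncard = dg G R v := by
  have e : edgesBetween G {v} (R : Set V) =
      (((R.filter (G.Adj v)).image (fun y => s(v, y)) : Finset (Sym2 V)) : Set (Sym2 V)) := by
    ext z
    simp only [edgesBetween, Set.mem_ofPred_eq, Set.mem_singleton_iff, exists_eq_left,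
      Finset.coe_image, Set.mem_image, Finset.mem_coe, Finset.mem_filter]
    constructor
    · rintro ⟨y, hy, h, rfl⟩
      exact ⟨y, ⟨hy, h⟩, rfl⟩
    · rintro ⟨y, ⟨hy, h⟩, rfl⟩
      exact ⟨y, hy, h, rfl⟩
  rw [e, Set.ncard_coe_finset, Finset.card_image_of_injective, Finset.card_filter]
  · rfl
  · intro a b hab
    exact Sym2.congr_right.mp hab

theorem two_between [Fintype V] (G : SimpleGraph V) [DecidableRel G.Adj] (v2 v3 : V)
    (h23 : v2 ≠ v3) (X : Finset V) (h2 : v2 ∉ X) (h3 : v3 ∉ X) :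
    ∑ x ∈ X, dg G {v2, v3} x ≤ (edgesBetween G (X : Set V) {v2, v3}).ncard := by
  rw [dg_swap, Finset.sum_pair h23, ← dg_between, ← dg_between, ← Set.ncard_union_eq]
  · apply Set.ncard_le_ncard _ (Set.toFinite _)
    rintro z (⟨a, rfl, y, hy, h, rfl⟩ | ⟨a, rfl, y, hy, h, rfl⟩)
    · exact ⟨y, hy, a, by simp, h.symm, Sym2.eq_swap⟩
    · exact ⟨y, hy, a, by simp, h.symm, Sym2.eq_swap⟩
  · rw [Set.disjoint_left]
    rintro z ⟨a, rfl, y, hy, h, rfl⟩ ⟨b, rfl, y', hy', h', he⟩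
    rw [Sym2.eq_iff] at he
    rcases he with ⟨h, _⟩ | ⟨h, _⟩
    · exact h23 h
    · subst h
      exact h2 hy'

end helpers

/-- Claim 4 of Case 2. Under the hypotheses of Case 2 there is a set
`X ⊆ V'` with `|E(X, {v2,v3})| ≥ s + 2` and
`|E(X)| ≤ max{0.5s − (d2 + d3 − |B|)/4 + 1.5, 1.5s − (d1 + 2d2 + 2d3)/3 + 2.5}`. -/
theorem exists_subset_case2' {V : Type*} [Fintype V] [DecidableEq V]
    (G : SimpleGraph V) [DecidableRel G.Adj]
    (m s : ℕ) (hm : m = G.edgeSet.ncard) (hs : m = 3 * s + 1)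
    (hlarge : 7 * 10 ^ 10 ≤ m)
    (ε : ℝ) (hε : ε = 2.7e-5)
    (B : Set V) (hB : B = {v : V | ε * m < (G.degree v : ℝ)})
    (V' : Set V) (hV' : V' = Bᶜ)
    (v1 v2 v3 : V) (h12 : v1 ≠ v2) (h13 : v1 ≠ v3) (h23 : v2 ≠ v3)
    (hv2B : v2 ∈ B) (hv3B : v3 ∈ B)
    (hv1 : G.degree v1 = G.maxDegree)
    (d1 d2 d3 : ℕ)
    (hd1 : d1 = (edgesBetween G {v1} ({v1, v2, v3}ᶜ : Set V)).ncard)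
    (hd2 : d2 = (edgesBetween G {v2} ({v1, v2, v3}ᶜ : Set V)).ncard)
    (hd3 : d3 = (edgesBetween G {v3} ({v1, v2, v3}ᶜ : Set V)).ncard)
    (hord : d3 ≤ d2 ∧ d2 ≤ d1)
    (hbig : 0.51 * (m : ℝ) < (d2 : ℝ) + (d3 : ℝ))
    (hΔ : G.maxDegree ≤ 2 * s) :
    ∃ X ⊆ V',
      s + 2 ≤ (edgesBetween G X {v2, v3}).ncard ∧
      ((edgesWithin G X).ncard : ℝ) ≤
        max (0.5 * (s : ℝ) - ((d2 : ℝ) + d3 - (B.ncard : ℝ)) / 4 + 1.5)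
            (1.5 * (s : ℝ) - ((d1 : ℝ) + 2 * d2 + 2 * d3) / 3 + 2.5) := by
  classical
  set T : Finset V := {v1, v2, v3} with hT
  set B1 : Finset V := Finset.univ.filter (fun v => v ∈ B ∧ v ∉ T) with hB1
  set X0 : Finset V := Finset.univ.filter (fun v => v ∉ B) with hX0
  have hv1B : v1 ∈ B := by
    rw [hB] at hv2B ⊢
    simp only [Set.mem_ofPred_eq] at hv2B ⊢
    have : G.degree v2 ≤ G.degree v1 := by rw [hv1]; exact G.degree_le_maxDegree v2
    have : (G.degree v2 : ℝ) ≤ G.degree v1 := by exact_mod_cast this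
    linarith
  have hTB : ∀ x ∈ T, x ∈ B := by
    intro x hx
    simp only [hT, Finset.mem_insert, Finset.mem_singleton] at hx
    rcases hx with rfl | rfl | rfl <;> assumption
  have hdis : Disjoint X0 B1 := by
    rw [Finset.disjoint_left]; intro x hx hx'
    simp only [hX0, hB1, Finset.mem_filter, Finset.mem_univ, true_and] at hx hx'
    exact hx hx'.1
  set R : Finset V := X0 ∪ B1 with hR
  have hRmem : ∀ x, x ∈ R ↔ x ∉ T := by
    intro x
    have := hTB x
    simp only [hR, hX0, hB1, Finset.mem_union, Finset.mem_filter, Finset.mem_univ, true_and]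
    tauto
  have hRT : Disjoint R T := by
    rw [Finset.disjoint_left]; intro x hx; exact (hRmem x).1 hx
  have hU : R ∪ T = Finset.univ := by
    ext x; have := hRmem x; simp only [Finset.mem_union, Finset.mem_univ, iff_true]; tauto
  have hRc : (({v1, v2, v3} : Set V)ᶜ) = (R : Set V) := by
    ext x
    rw [Finset.mem_coe, hRmem]
    simp [hT]
  rw [hRc, dg_between] at hd1 hd2 hd3
  have hTcard : T.card ≤ 3 := Finset.card_le_three
  have c1 : 2 * m = dd G R + dd G T + 2 * (d1 + d2 + d3) := by
    rw [hm, ← dd_univ, ← hU, dd_union G R T hRT, hd1, hd2, hd3, hT,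
      Finset.sum_insert (by simp [h12, h13]), Finset.sum_pair h23]
    ring
  have hdegB : ∀ x ∈ B1, 100 ≤ dg G R x := by
    intro x hx
    have h1 := dg_univ G x
    rw [← hU, dg_union G R T hRT] at h1
    have h2 := dg_le_card G T x
    have hxB : x ∈ B := by
      simp only [hB1, Finset.mem_filter] at hx; exact hx.2.1
    rw [hB, Set.mem_ofPred_eq, hε] at hxB
    have h3 : (7 * 10 ^ 10 : ℝ) ≤ m := by exact_mod_cast hlarge
    have h4 : (103 : ℝ) < G.degree x := by linarith
    have h5 : 103 < G.degree x := by exact_mod_cast h4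
    omega
  have c2 : dd G X0 + 100 * B1.card ≤ dd G R := by
    have h1 : dd G R = ∑ x ∈ X0, dg G R x + ∑ x ∈ B1, dg G R x := by
      rw [← Finset.sum_union hdis]; rfl
    have h2 : B1.card * 100 ≤ ∑ x ∈ B1, dg G R x := by
      rw [← smul_eq_mul]; exact Finset.card_nsmul_le_sum _ _ _ hdegB
    have h3 : dd G X0 ≤ ∑ x ∈ X0, dg G R x := by
      apply Finset.sum_le_sum
      intro x _
      rw [hR, dg_union G X0 B1 hdis]
      omega
    omega
  set w : V → ℕ := fun x => dg G {v2, v3} x with hw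
  have hw2 : ∀ x, w x ≤ 2 := fun x => (dg_le_card G _ x).trans Finset.card_le_two
  have c3 : d2 + d3 ≤ ∑ x ∈ X0, w x + 2 * B1.card := by
    have h1 : ∑ x ∈ R, w x = d2 + d3 := by
      rw [hw, dg_swap, Finset.sum_pair h23, hd2, hd3]
    have h2 : ∑ x ∈ B1, w x ≤ B1.card * 2 := by
      rw [← smul_eq_mul]; exact Finset.sum_le_card_nsmul _ _ _ (fun x _ => hw2 x)
    rw [hR, Finset.sum_union hdis] at h1
    omega
  have hbig' : 51 * m < 100 * (d2 + d3) := by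
    have : (51 * m : ℝ) < 100 * (d2 + d3) := by linarith
    exact_mod_cast this
  obtain ⟨Y, hYX, hYK, hY1, hY2⟩ := stepA G w hw2 (s + 2) X0 (by omega) (by omega)
  obtain ⟨Z, hZY, hZK, hZ⟩ := stepB G w hw2 (s + 2) Y hYK
  have hZX := hZY.trans hYX
  have hZB : ∀ x ∈ Z, x ∉ B := by
    intro x hx
    have := hZX hx
    simp only [hX0, Finset.mem_filter] at this
    exact this.2
  refine ⟨(Z : Set V), ?_, ?_, ?_⟩
  · rw [hV']; intro x hx; exact hZB x hx
  · exact hZK.trans (two_between G v2 v3 h23 Z (fun h => hZB _ h hv2B) (fun h => hZB _ h hv3B))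
  · have hE := dd_within G Z
    rcases hZ with h | h
    · have h0 : (edgesWithin G (Z : Set V)).ncard = 0 := by omega
      rw [h0]
      apply le_max_of_le_left
      have h1 : d2 + d3 ≤ 2 * s + 1 := by omega
      have h2 : (d2 + d3 : ℝ) ≤ 2 * s + 1 := by exact_mod_cast h1
      have h3 : (0 : ℝ) ≤ B.ncard := Nat.cast_nonneg _
      norm_num
      linarith
    · apply le_max_of_le_right
      have h1 : 6 * (edgesWithin G (Z : Set V)).ncard + 2 * d1 + 4 * d2 + 4 * d3
          ≤ 9 * s + 15 := by omega
      have h2 : (6 * (edgesWithin G (Z : Set V)).ncard + 2 * d1 + 4 * d2 + 4 * d3 : ℝ)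
          ≤ 9 * s + 15 := by exact_mod_cast h1
      norm_num
      linarith
end
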